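/- arXiv:math/0702027 — 2 statements merged into one kernel-verified Lean document; each statement's English description precedes it below -/
import Mathlib

section
/- If n is a positive integer and m is a positive odd integer, then the power series E(q^{mn})^{n(m-1)/2 - m} E(q^m)^{(m+1)/2} E(q^n) / E(q) has nonnegative coefficients. -/
/-- `E(q) = ∏_{n ≥ 1} (1 - qⁿ)`. -/
noncomputable def Eprod (q : ℂ) : ℂ := ∏' n : ℕ, (1 - q ^ (n + 1))

/-- The finite `q`-Pochhammer product `(1 - q)(1 - q²)⋯(1 - qᵏ)`. -/
noncomputable def qPochFin (q : ℂ) (k : ℕ) : ℂ := ∏ i ∈ Finset.range k, (1 - q ^ (i + 1))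

lemma qPochFin_succ (q : ℂ) (k : ℕ) :
    qPochFin q (k + 1) = qPochFin q k * (1 - q ^ (k + 1)) :=
  Finset.prod_range_succ _ _

lemma one_sub_ne_zero_of_norm_lt_one {a : ℂ} (ha : ‖a‖ < 1) : 1 - a ≠ 0 := by
  intro h
  rw [← sub_eq_zero.mp h] at ha
  simp at ha

lemma norm_pow_succ_lt_one {q : ℂ} (hq : ‖q‖ < 1) (k : ℕ) : ‖q ^ (k + 1)‖ < 1 := by
  rw [norm_pow]
  exact pow_lt_one₀ (norm_nonneg _) hq (by omega)

lemma qPochFin_ne_zero {q : ℂ} (hq : ‖q‖ < 1) (k : ℕ) : qPochFin q k ≠ 0 :=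
  Finset.prod_ne_zero_iff.mpr fun i _ =>
    one_sub_ne_zero_of_norm_lt_one (norm_pow_succ_lt_one hq i)

/-- Gaussian binomial coefficients. -/
noncomputable def gaussBinom (q : ℂ) : ℕ → ℕ → ℂ
  | _, 0 => 1
  | 0, _ + 1 => 0
  | M + 1, j + 1 => gaussBinom q M (j + 1) + q ^ (M - j) * gaussBinom q M j

lemma gaussBinom_succ_succ (q : ℂ) (M j : ℕ) :
    gaussBinom q (M + 1) (j + 1) = gaussBinom q M (j + 1) + q ^ (M - j) * gaussBinom q M j := rfl

lemma gaussBinom_eq_zero (q : ℂ) {M j : ℕ} (h : M < j) : gaussBinom q M j = 0 := by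
  induction M generalizing j with
  | zero => obtain ⟨j, rfl⟩ : ∃ i, j = i + 1 := ⟨j - 1, by omega⟩; simp [gaussBinom]
  | succ M ih =>
    obtain ⟨j, rfl⟩ : ∃ i, j = i + 1 := ⟨j - 1, by omega⟩
    simp [gaussBinom, ih (j := j) (by omega), ih (j := j + 1) (by omega)]

lemma gaussBinom_self (q : ℂ) (M : ℕ) : gaussBinom q M M = 1 := by
  induction M with
  | zero => simp [gaussBinom]
  | succ M ih => simp [gaussBinom, ih, gaussBinom_eq_zero]

lemma gaussBinom_mul (q : ℂ) (a b : ℕ) :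
    gaussBinom q (a + b) a * (qPochFin q a * qPochFin q b) = qPochFin q (a + b) := by
  induction h : a + b generalizing a b with
  | zero =>
    obtain ⟨rfl, rfl⟩ : a = 0 ∧ b = 0 := by omega
    simp [gaussBinom, qPochFin]
  | succ M ih =>
    rcases a with _ | a
    · obtain rfl : b = M + 1 := by omega
      simp [gaussBinom, qPochFin]
    rcases b with _ | b
    · obtain rfl : a = M := by omega
      simp [gaussBinom_self, qPochFin]
    have h1 := ih (a + 1) b (by omega)
    have h2 := ih a (b + 1) (by omega)
    have hM : M - a = b + 1 := by omega
    obtain rfl : M = a + b + 1 := by omega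
    rw [gaussBinom_succ_succ, hM]
    rw [qPochFin_succ q a] at h1 ⊢
    rw [qPochFin_succ q b] at h2 ⊢
    rw [qPochFin_succ q (a + b + 1)]
    linear_combination (1 - q ^ (b + 1)) * h1 + q ^ (b + 1) * (1 - q ^ (a + 1)) * h2

/-- The finite `q`-binomial theorem. -/
lemma prod_one_add_mul_pow (q z : ℂ) (M : ℕ) :
    ∏ k ∈ Finset.range M, (1 + z * q ^ k) =
      ∑ j ∈ Finset.range (M + 1), gaussBinom q M j * q ^ (j.choose 2) * z ^ j := by
  induction M with
  | zero => simp [gaussBinom]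
  | succ M ih =>
    rw [Finset.prod_range_succ, ih, Finset.sum_range_succ' _ (M + 1), mul_add, mul_one,
      Finset.sum_mul]
    have h1 : ∀ j ∈ Finset.range (M + 1),
        gaussBinom q (M + 1) (j + 1) * q ^ ((j + 1).choose 2) * z ^ (j + 1) =
        gaussBinom q M (j + 1) * q ^ ((j + 1).choose 2) * z ^ (j + 1) +
        gaussBinom q M j * q ^ (j.choose 2) * z ^ j * (z * q ^ M) := by
      intro j hj
      have hj' : j ≤ M := by simpa [Nat.lt_succ_iff] using hj
      have hc : (j + 1).choose 2 = j + j.choose 2 := by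
        rw [Nat.choose_succ_succ' j 1, Nat.choose_one_right]
      have hp : q ^ M = q ^ (M - j) * q ^ j := by rw [← pow_add]; congr 1; omega
      simp only [gaussBinom, hc, hp]
      ring
    rw [Finset.sum_congr rfl h1, Finset.sum_add_distrib, Finset.sum_range_succ' _ M,
      Finset.sum_range_succ (fun j => gaussBinom q M (j + 1) * _ * _) M,
      gaussBinom_eq_zero q (Nat.lt_succ_self M)]
    simp [gaussBinom]
    ring

/-- The exponents `k (k - 1) / 2` of the theta series. -/
def tri (k : ℤ) : ℤ := k * (k - 1) / 2

lemma two_mul_tri (k : ℤ) : 2 * tri k = k * (k - 1) :=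
  Int.mul_ediv_cancel' (by
    have := Int.even_mul_pred_self k
    exact this.two_dvd)

lemma tri_nonneg (k : ℤ) : 0 ≤ tri k := by
  have h := two_mul_tri k
  rcases le_or_gt k 0 with hk | hk <;> nlinarith

lemma tri_add (a b : ℤ) : tri (a + b) = tri a + tri b + a * b := by
  linarith [two_mul_tri a, two_mul_tri b, two_mul_tri (a + b)]

lemma tri_natCast (n : ℕ) : tri n = (n.choose 2 : ℕ) := by
  induction n with
  | zero => simp [tri]
  | succ n ih =>
    rw [Nat.choose_succ_succ' n 1, Nat.choose_one_right, Nat.cast_succ, tri_add, ih]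
    simp [tri]
    ring

lemma summable_pow_tri_mul_zpow {r w : ℝ} (hr : 0 < r) (hr1 : r < 1) (hw : 0 < w) :
    Summable fun j : ℤ => r ^ tri j * w ^ j := by
  have key : ∀ w : ℝ, 0 < w → Summable fun n : ℕ => r ^ tri (n : ℤ) * w ^ (n : ℤ) := by
    intro w hw
    refine summable_of_ratio_test_tendsto_lt_one (l := 0) one_pos
      (.of_forall fun n => by positivity) ?_
    have h : Filter.Tendsto (fun n : ℕ => r ^ n * w) Filter.atTop (nhds (0 * w)) :=
      (tendsto_pow_atTop_nhds_zero_of_lt_one hr.le hr1).mul_const w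
    rw [zero_mul] at h
    refine h.congr fun n => ?_
    have h1 : tri ((n + 1 : ℕ) : ℤ) = tri n + n := by
      push_cast
      rw [tri_add]
      simp [tri]
    rw [h1, Real.norm_of_nonneg (by positivity), Real.norm_of_nonneg (by positivity),
      zpow_add₀ hr.ne', Nat.cast_succ, zpow_add₀ hw.ne', zpow_one]
    field_simp
    simp
  refine Summable.of_nat_of_neg (key w hw) ?_
  refine (key (r * w⁻¹) (by positivity)).congr fun n => ?_
  have h1 : tri (-(n : ℤ)) = tri n + n := by
    linarith [two_mul_tri n, two_mul_tri (-n)]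
  rw [h1, zpow_add₀ hr.ne', mul_zpow, inv_zpow, zpow_neg]
  ring

lemma norm_pow_tri_mul_zpow (q z : ℂ) (j : ℤ) :
    ‖q ^ tri j * z ^ j‖ = ‖q‖ ^ tri j * ‖z‖ ^ j := by
  rw [norm_mul, norm_zpow, norm_zpow]

lemma summable_norm_theta {q z : ℂ} (hq0 : q ≠ 0) (hq : ‖q‖ < 1) (hz : z ≠ 0) :
    Summable fun j : ℤ => ‖q ^ tri j * z ^ j‖ := by
  simp_rw [norm_pow_tri_mul_zpow]
  exact summable_pow_tri_mul_zpow (norm_pos_iff.mpr hq0) hq (norm_pos_iff.mpr hz)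

lemma multipliable_one_add_mul_pow {q : ℂ} (hq : ‖q‖ < 1) (z : ℂ) :
    Multipliable fun k : ℕ => 1 + z * q ^ k := by
  apply multipliable_one_add_of_summable
  simp_rw [norm_mul, norm_pow]
  exact (summable_geometric_of_lt_one (norm_nonneg _) hq).mul_left _

lemma tendsto_qPochFin {q : ℂ} (hq : ‖q‖ < 1) :
    Filter.Tendsto (qPochFin q) Filter.atTop (nhds (Eprod q)) :=
  (ModularForm.multipliable_one_sub_pow hq).hasProd.tendsto_prod_nat

lemma Eprod_ne_zero {q : ℂ} (hq : ‖q‖ < 1) : Eprod q ≠ 0 := by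
  refine tprod_one_add_ne_zero_of_summable (f := fun n : ℕ => -q ^ (n + 1)) (fun i => ?_) ?_
  · simpa [← sub_eq_add_neg] using! one_sub_ne_zero_of_norm_lt_one (norm_pow_succ_lt_one hq i)
  · simpa using (summable_nat_add_iff 1).mpr (summable_geometric_of_lt_one (norm_nonneg _) hq)

lemma exists_norm_gaussBinom_le {q : ℂ} (hq : ‖q‖ < 1) :
    ∃ B : ℝ, 0 ≤ B ∧ ∀ M j, ‖gaussBinom q M j‖ ≤ B := by
  obtain ⟨B, hB⟩ := (Metric.isBounded_range_of_tendsto _ (tendsto_qPochFin hq)).exists_norm_le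
  obtain ⟨C, hC⟩ := (Metric.isBounded_range_of_tendsto _
    ((tendsto_qPochFin hq).inv₀ (Eprod_ne_zero hq))).exists_norm_le
  have hB' := fun k => hB _ (Set.mem_range_self k)
  have hC' := fun k => hC _ (Set.mem_range_self k)
  have hB0 : 0 ≤ B := (norm_nonneg _).trans (hB' 0)
  have hC0 : 0 ≤ C := (norm_nonneg _).trans (hC' 0)
  refine ⟨B * (C * C), by positivity, fun M j => ?_⟩
  rcases lt_or_ge M j with h | h
  · rw [gaussBinom_eq_zero q h, norm_zero]
    positivity
  · obtain ⟨b, rfl⟩ := Nat.exists_eq_add_of_le h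
    have h1 : gaussBinom q (j + b) j =
        qPochFin q (j + b) * ((qPochFin q j)⁻¹ * (qPochFin q b)⁻¹) := by
      rw [← gaussBinom_mul q j b]
      field_simp [qPochFin_ne_zero hq j, qPochFin_ne_zero hq b]
    rw [h1, norm_mul, norm_mul]
    gcongr
    · exact hB' _
    · exact hC' _
    · exact hC' _

lemma tendsto_gaussBinom {q : ℂ} (hq : ‖q‖ < 1) (j : ℤ) :
    Filter.Tendsto (fun N : ℕ => gaussBinom q (2 * N) (N + j).toNat) Filter.atTop
      (nhds (Eprod q)⁻¹) := by
  have hE := Eprod_ne_zero hq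
  have key : ∀ f : ℕ → ℕ, (∀ B, ∀ᶠ N in Filter.atTop, B ≤ f N) →
      Filter.Tendsto (fun N => qPochFin q (f N)) Filter.atTop (nhds (Eprod q)) :=
    fun f hf => (tendsto_qPochFin hq).comp (Filter.tendsto_atTop.mpr hf)
  have h := (key (fun N => 2 * N) fun B => by
      filter_upwards [Filter.eventually_ge_atTop B] with N hN; omega).div
    ((key (fun N : ℕ => (N + j).toNat) fun B => by
      filter_upwards [Filter.eventually_ge_atTop (B + j.natAbs)] with N hN; omega).mul
    (key (fun N : ℕ => (N - j).toNat) fun B => by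
      filter_upwards [Filter.eventually_ge_atTop (B + j.natAbs)] with N hN; omega))
    (mul_ne_zero hE hE)
  rw [div_mul_cancel_left₀ hE] at h
  refine h.congr' ?_
  filter_upwards [Filter.eventually_ge_atTop j.natAbs] with N hN
  have h2 : 2 * N = (N + j).toNat + (N - j).toNat := by omega
  rw [Pi.div_apply, div_eq_iff (mul_ne_zero (qPochFin_ne_zero hq _) (qPochFin_ne_zero hq _))]
  rw [h2, gaussBinom_mul]

lemma prod_mul_prod_eq_tsum {q z : ℂ} (hq0 : q ≠ 0) (hz : z ≠ 0) (N : ℕ) :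
    (∏ k ∈ Finset.range N, (1 + z * q ^ k)) * ∏ k ∈ Finset.range N, (1 + z⁻¹ * q * q ^ k) =
      ∑' j : ℤ, (if -(N : ℤ) ≤ j then gaussBinom q (2 * N) (N + j).toNat else 0) *
        (q ^ tri j * z ^ j) := by
  have hinj : Function.Injective fun i : ℕ => (i : ℤ) - N := fun a b h => by simpa using h
  rw [← hinj.tsum_eq, tsum_eq_sum (s := Finset.range (2 * N + 1))]
  rotate_left
  · intro i hi
    rw [gaussBinom_eq_zero]
    · simp
    · simp at hi; omega
  · intro j hj
    by_cases h : -(N : ℤ) ≤ j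
    · exact ⟨(N + j).toNat, by simp only; omega⟩
    · simp [h] at hj
  have hb := prod_one_add_mul_pow q (z * q ^ (-(N : ℤ))) (2 * N)
  rw [two_mul, Finset.prod_range_add, ← Finset.prod_range_reflect, ← two_mul] at hb
  have h1 : ∏ k ∈ Finset.range N, (1 + z * q ^ (-(N : ℤ)) * q ^ (N + k)) =
      ∏ k ∈ Finset.range N, (1 + z * q ^ k) := by
    refine Finset.prod_congr rfl fun k _ => ?_
    rw [pow_add, zpow_neg, zpow_natCast]
    field_simp
  have h2 : ∏ k ∈ Finset.range N, (1 + z * q ^ (-(N : ℤ)) * q ^ (N - 1 - k)) =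
      (z ^ N * (q ^ (-((N + 1).choose 2 : ℕ) : ℤ))) *
        ∏ k ∈ Finset.range N, (1 + z⁻¹ * q * q ^ k) := by
    have h3 : z ^ N * (q ^ (-((N + 1).choose 2 : ℕ) : ℤ)) =
        ∏ k ∈ Finset.range N, (z * q ^ (-((k : ℤ) + 1))) := by
      clear hb h1
      induction N with
      | zero => simp
      | succ N ih =>
        rw [Finset.prod_range_succ, ← ih ?_, Nat.choose_succ_succ' (N + 1) 1, Nat.choose_one_right]
        · push_cast
          rw [neg_add, zpow_add₀ hq0]
          ring
        · intro a b h; simpa using h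
    rw [h3, ← Finset.prod_mul_distrib]
    refine Finset.prod_congr rfl fun k hk => ?_
    have hk' : k < N := by simpa using hk
    have h4 : q ^ (-(N : ℤ)) * q ^ (N - 1 - k) = q ^ (-((k : ℤ) + 1)) := by
      rw [← zpow_natCast, ← zpow_add₀ hq0]
      congr 1
      omega
    have h5 : q ^ (-((k : ℤ) + 1)) * (q * q ^ k) = 1 := by
      rw [← pow_succ', ← zpow_natCast, ← zpow_add₀ hq0]
      simp
    rw [mul_assoc z, h4]
    have h6 : z * z⁻¹ = 1 := mul_inv_cancel₀ hz
    linear_combination (-(z * z⁻¹)) * h5 - h6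
  rw [h1, h2] at hb
  have h7 : z ^ N * (q ^ (-((N + 1).choose 2 : ℕ) : ℤ)) ≠ 0 :=
    mul_ne_zero (pow_ne_zero _ hz) (zpow_ne_zero _ hq0)
  apply mul_left_cancel₀ h7
  rw [mul_comm (∏ k ∈ Finset.range N, (1 + z * q ^ k)), ← mul_assoc, hb, Finset.mul_sum]
  refine Finset.sum_congr rfl fun i _ => ?_
  have h8 : (N + ((i : ℤ) - N)).toNat = i := by omega
  have h9 : -(N : ℤ) ≤ (i : ℤ) - N := by omega
  simp only [h8, h9, if_true]
  have h10 : (-((N + 1).choose 2 : ℕ) : ℤ) + tri ((i : ℤ) - N) =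
      (i.choose 2 : ℕ) + (-(N : ℤ)) * i := by
    rw [← tri_natCast, ← tri_natCast]
    push_cast
    linarith [two_mul_tri ((N : ℤ) + 1), two_mul_tri ((i : ℤ) - N), two_mul_tri (i : ℤ)]
  have h11 : q ^ (-((N + 1).choose 2 : ℕ) : ℤ) * q ^ tri ((i : ℤ) - N) =
      q ^ (i.choose 2) * (q ^ (-(N : ℤ))) ^ i := by
    rw [← zpow_add₀ hq0, h10, zpow_add₀ hq0, zpow_mul, zpow_natCast, zpow_natCast]
  have h12 : z ^ N * z ^ ((i : ℤ) - N) = z ^ i := by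
    rw [← zpow_natCast, ← zpow_natCast, ← zpow_add₀ hz]
    congr 1
    ring
  rw [mul_pow, ← h12]
  linear_combination (-(gaussBinom q (2 * N) i * z ^ N * z ^ ((i : ℤ) - N))) * h11

/-- The Jacobi triple product identity. -/
theorem jacobi_triple_product {q z : ℂ} (hq0 : q ≠ 0) (hq : ‖q‖ < 1) (hz : z ≠ 0) :
    ∑' j : ℤ, q ^ tri j * z ^ j =
      Eprod q * ((∏' k : ℕ, (1 + z * q ^ k)) * ∏' k : ℕ, (1 + z⁻¹ * q * q ^ k)) := by
  have hE := Eprod_ne_zero hq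
  obtain ⟨B, hB0, hB⟩ := exists_norm_gaussBinom_le hq
  have h1 := ((multipliable_one_add_mul_pow hq z).hasProd.tendsto_prod_nat).mul
    (multipliable_one_add_mul_pow hq (z⁻¹ * q)).hasProd.tendsto_prod_nat
  simp_rw [prod_mul_prod_eq_tsum hq0 hz] at h1
  have h2 := tendsto_tsum_of_dominated_convergence
    (f := fun (N : ℕ) (j : ℤ) =>
      (if -(N : ℤ) ≤ j then gaussBinom q (2 * N) (N + j).toNat else 0) * (q ^ tri j * z ^ j))
    (g := fun j => (Eprod q)⁻¹ * (q ^ tri j * z ^ j)) (𝓕 := Filter.atTop)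
    ((summable_norm_theta hq0 hq hz).mul_left B) ?_ ?_
  · rw [tendsto_nhds_unique h1 h2, tsum_mul_left, mul_inv_cancel_left₀ hE]
  · intro j
    refine Filter.Tendsto.mul_const _ ((tendsto_gaussBinom hq j).congr' ?_)
    filter_upwards [Filter.eventually_ge_atTop j.natAbs] with N hN
    rw [if_pos (by omega)]
  · refine .of_forall fun N j => ?_
    rw [norm_mul]
    gcongr
    split_ifs
    · exact hB _ _
    · simpa using hB0

/-- The theta series `∑ p ^ (k (k - 1) / 2) w ^ k`. -/
noncomputable def thetaSeries (p w : ℂ) : ℂ := ∑' k : ℤ, p ^ tri k * w ^ k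

/-- The infinite product `∏_{k ≥ 0} (1 - a pᵏ)`. -/
noncomputable def qPoch (a p : ℂ) : ℂ := ∏' k : ℕ, (1 - a * p ^ k)

lemma thetaSeries_neg {p z : ℂ} (hp0 : p ≠ 0) (hp : ‖p‖ < 1) (hz : z ≠ 0) :
    thetaSeries p (-z) = Eprod p * (qPoch z p * qPoch (z⁻¹ * p) p) := by
  rw [thetaSeries, jacobi_triple_product hp0 hp (neg_ne_zero.mpr hz)]
  simp only [qPoch, inv_neg, neg_mul, ← sub_eq_add_neg]

lemma multipliable_one_sub_mul_pow {p : ℂ} (hp : ‖p‖ < 1) (a : ℂ) :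
    Multipliable fun k : ℕ => 1 - a * p ^ k := by
  simpa [sub_eq_add_neg] using multipliable_one_add_mul_pow hp (-a)

lemma norm_pow_lt_one {p : ℂ} (hp : ‖p‖ < 1) {n : ℕ} (hn : 0 < n) : ‖p ^ n‖ < 1 := by
  rw [norm_pow]
  exact pow_lt_one₀ (norm_nonneg _) hp hn.ne'

/-- Splitting `E(p)` along the residue classes modulo `n`. -/
lemma prod_qPoch_eq_Eprod {p : ℂ} (hp : ‖p‖ < 1) {n : ℕ} (hn : 0 < n) :
    ∏ r ∈ Finset.range n, qPoch (p ^ (r + 1)) (p ^ n) = Eprod p := by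
  have h1 : ∀ K : ℕ, ∏ r ∈ Finset.range n, ∏ k ∈ Finset.range K, (1 - p ^ (r + 1) * (p ^ n) ^ k) =
      qPochFin p (n * K) := by
    intro K
    rw [Finset.prod_comm]
    induction K with
    | zero => simp [qPochFin]
    | succ K ih =>
      rw [Finset.prod_range_succ, ih, qPochFin, qPochFin, Nat.mul_succ, Finset.prod_range_add]
      congr 1
      refine Finset.prod_congr rfl fun r _ => ?_
      rw [← pow_mul, ← pow_add]
      congr 2
      ring
  have h2 := tendsto_finsetProd (Finset.range n) fun r _ =>
    (multipliable_one_sub_mul_pow (norm_pow_lt_one hp hn) (p ^ (r + 1))).hasProd.tendsto_prod_nat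
  simp_rw [h1] at h2
  refine tendsto_nhds_unique h2 ((tendsto_qPochFin hp).comp (Filter.tendsto_atTop.mpr fun B => ?_))
  filter_upwards [Filter.eventually_ge_atTop B] with K hK
  nlinarith

lemma qPoch_self (p : ℂ) : qPoch p p = Eprod p := by
  simp only [qPoch, Eprod, pow_succ']

lemma prod_qPoch_mul_Eprod {p : ℂ} (hp : ‖p‖ < 1) (N : ℕ) :
    (∏ r ∈ Finset.range N, qPoch (p ^ (r + 1)) (p ^ (N + 1))) * Eprod (p ^ (N + 1)) = Eprod p := by
  rw [← prod_qPoch_eq_Eprod hp N.succ_pos, Finset.prod_range_succ, ← qPoch_self]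

lemma thetaSeries_mul_zpow {p : ℂ} (hp0 : p ≠ 0) {w : ℂ} (hw : w ≠ 0) (l : ℤ) :
    thetaSeries p (w * p ^ (-l)) = w ^ l * p ^ (-tri (l + 1)) * thetaSeries p w := by
  rw [thetaSeries, thetaSeries, ← (Equiv.addRight l).tsum_eq, ← tsum_mul_left]
  refine tsum_congr fun k => ?_
  rw [Equiv.coe_addRight, mul_zpow, ← zpow_mul, zpow_add₀ hw]
  have h : tri (k + l) + -l * (k + l) = -tri (l + 1) + tri k := by
    linarith [two_mul_tri (k + l), two_mul_tri (l + 1), two_mul_tri k]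
  have h' : p ^ tri (k + l) * p ^ (-l * (k + l)) = p ^ (-tri (l + 1)) * p ^ tri k := by
    rw [← zpow_add₀ hp0, ← zpow_add₀ hp0, h]
  linear_combination (w ^ k * w ^ l) * h'

lemma thetaSeries_neg_zpow_eq_zero {p : ℂ} (hp0 : p ≠ 0) (d : ℤ) :
    thetaSeries p (-p ^ d) = 0 := by
  have h : thetaSeries p (-p ^ d) = -thetaSeries p (-p ^ d) := by
    conv_lhs => rw [thetaSeries, ← (Equiv.subLeft (1 - 2 * d)).tsum_eq]
    rw [thetaSeries, ← tsum_neg]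
    refine tsum_congr fun k => ?_
    rw [Equiv.subLeft_apply, neg_eq_neg_one_mul (p ^ d), mul_zpow, mul_zpow, ← zpow_mul, ← zpow_mul]
    have h1 : tri (1 - 2 * d - k) + d * (1 - 2 * d - k) = tri k + d * k := by
      linarith [two_mul_tri (1 - 2 * d - k), two_mul_tri k]
    have h2 : p ^ tri (1 - 2 * d - k) * p ^ (d * (1 - 2 * d - k)) = p ^ tri k * p ^ (d * k) := by
      rw [← zpow_add₀ hp0, ← zpow_add₀ hp0, h1]
    have h3 : (-1 : ℂ) ^ (1 - 2 * d - k) = -(-1) ^ k := by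
      rw [zpow_sub₀ (by norm_num), zpow_sub₀ (by norm_num), zpow_mul]
      rcases Int.even_or_odd k with hk | hk
      · simp [hk.neg_one_zpow]
      · simp [hk.neg_one_zpow]
    rw [h3]
    linear_combination (-(-1 : ℂ) ^ k) * h2
  exact self_eq_neg.mp h

lemma summable_norm_prod_pi {N : ℕ} {f : Fin N → ℤ → ℂ} (hf : ∀ j, Summable fun y => ‖f j y‖) :
    Summable (fun x : Fin N → ℤ => ‖∏ j, f j (x j)‖) ∧
      ∑' x : Fin N → ℤ, ∏ j, f j (x j) = ∏ j, ∑' y, f j y := by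
  induction N with
  | zero => exact ⟨Summable.of_finite, by simp⟩
  | succ N ih =>
    obtain ⟨h1, h2⟩ := ih (f := fun j => f j.succ) fun j => hf _
    constructor
    · rw [← (Fin.consEquiv fun _ => ℤ).summable_iff]
      refine ((hf 0).mul_norm h1).congr fun x => ?_
      simp [Fin.consEquiv, Fin.prod_univ_succ]
    · rw [← (Fin.consEquiv fun _ => ℤ).tsum_eq, Fin.prod_univ_succ, ← h2,
        tsum_mul_tsum_of_summable_norm (hf 0) h1]
      refine tsum_congr fun x => ?_
      simp [Fin.consEquiv, Fin.prod_univ_succ]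

/-- The quadratic exponent in the lattice sum expanding
`E(p) E(pⁿ)ⁿ⁻² [zⁿ; pⁿ]_∞ / [z; p]_∞`, where `n = N + 1`. -/
def coreForm {N : ℕ} (x : Fin N → ℤ) : ℤ :=
  ∑ j, ((N + 1) * tri (x j) + (j + 1) * x j) - tri (-∑ j, x j)

lemma coreForm_succ {N : ℕ} (x : Fin (N + 1) → ℤ) :
    coreForm x = coreForm (fun j : Fin N => x j.castSucc) +
      ∑ j : Fin N, tri (x j.castSucc - x (Fin.last N)) + tri (x (Fin.last N)) := by
  have h : ∀ a b : ℤ, tri (a - b) = tri a + tri b - a * b + b := fun a b => by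
    linarith [two_mul_tri a, two_mul_tri b, two_mul_tri (a - b)]
  simp only [coreForm, h, Fin.sum_univ_castSucc, Finset.sum_add_distrib, Finset.sum_sub_distrib,
    ← Finset.mul_sum, ← Finset.sum_mul, Fin.val_castSucc, Fin.val_last, Finset.sum_const,
    Finset.card_univ, Fintype.card_fin, nsmul_eq_mul]
  set s := ∑ j : Fin N, x j.castSucc
  set y := x (Fin.last N)
  push_cast
  linarith [two_mul_tri (-(s + y)), two_mul_tri (-s), two_mul_tri y]

lemma sum_tri_le_coreForm {N : ℕ} (x : Fin N → ℤ) : ∑ j, tri (x j) ≤ coreForm x := by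
  induction N with
  | zero => simp [coreForm, tri]
  | succ N ih =>
    rw [coreForm_succ, Fin.sum_univ_castSucc]
    have h1 := ih fun j => x j.castSucc
    have h2 : 0 ≤ ∑ j : Fin N, tri (x j.castSucc - x (Fin.last N)) :=
      Finset.sum_nonneg fun _ _ => tri_nonneg _
    linarith

lemma sum_tri_add_one_le_coreForm {N : ℕ} (x : Fin N → ℤ) :
    ∑ j, tri (x j + 1) ≤ coreForm x + ∑ j, x j := by
  induction N with
  | zero => simp [coreForm, tri]
  | succ N ih =>
    rw [coreForm_succ, Fin.sum_univ_castSucc, Fin.sum_univ_castSucc]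
    have h1 := ih fun j => x j.castSucc
    have h2 : 0 ≤ ∑ j : Fin N, tri (x j.castSucc - x (Fin.last N)) :=
      Finset.sum_nonneg fun _ _ => tri_nonneg _
    have h3 : tri (x (Fin.last N) + 1) = tri (x (Fin.last N)) + x (Fin.last N) := by
      rw [tri_add]
      simp [tri]
    linarith

lemma coreForm_nonneg {N : ℕ} (x : Fin N → ℤ) : 0 ≤ coreForm x :=
  (Finset.sum_nonneg fun _ _ => tri_nonneg _).trans (sum_tri_le_coreForm x)

lemma coreForm_add_sum_nonneg {N : ℕ} (x : Fin N → ℤ) : 0 ≤ coreForm x + ∑ j, x j :=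
  (Finset.sum_nonneg fun _ _ => tri_nonneg _).trans (sum_tri_add_one_le_coreForm x)

lemma eq_zero_of_coreForm_eq_zero {N : ℕ} {x : Fin N → ℤ} (h1 : coreForm x = 0)
    (h2 : coreForm x + ∑ j, x j = 0) : x = 0 := by
  have h3 := sum_tri_le_coreForm x
  have h4 := sum_tri_add_one_le_coreForm x
  rw [h1] at h3
  rw [h2] at h4
  have h5 := (Finset.sum_eq_zero_iff_of_nonneg fun j _ => tri_nonneg (x j)).mp
    (le_antisymm h3 (Finset.sum_nonneg fun _ _ => tri_nonneg _))
  have h6 := (Finset.sum_eq_zero_iff_of_nonneg fun j _ => tri_nonneg (x j + 1)).mp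
    (le_antisymm h4 (Finset.sum_nonneg fun _ _ => tri_nonneg _))
  funext j
  have h7 := h5 j (Finset.mem_univ j)
  have h8 := h6 j (Finset.mem_univ j)
  rw [tri_add, h7] at h8
  simpa [tri] using h8

lemma summable_norm_coreForm {N : ℕ} {p z : ℂ} (hp0 : p ≠ 0) (hpz : ‖p‖ < ‖z‖) (hz : ‖z‖ < 1) :
    Summable fun x : Fin N → ℤ => ‖p ^ coreForm x * z ^ ∑ j, x j‖ := by
  have hz0 : z ≠ 0 := norm_pos_iff.mp ((norm_nonneg p).trans_lt hpz)
  have hzp : 0 < ‖z‖ := norm_pos_iff.mpr hz0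
  have hpp : 0 < ‖p‖ := norm_pos_iff.mpr hp0
  refine Summable.of_nonneg_of_le (fun _ => norm_nonneg _) (fun x => ?_)
    (summable_norm_prod_pi (N := N) (f := fun _ y => p ^ tri y * z ^ y) fun _ =>
      summable_norm_theta hp0 (hpz.trans hz) hz0).1
  have split : ∀ a b : ℤ, ‖p‖ ^ a * ‖z‖ ^ b = (‖p‖ / ‖z‖) ^ a * ‖z‖ ^ (a + b) := by
    intro a b
    rw [div_zpow, zpow_add₀ hzp.ne']
    field_simp
  rw [Finset.prod_mul_distrib, norm_mul, norm_mul, norm_prod, norm_prod, norm_zpow, norm_zpow]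
  simp_rw [norm_zpow]
  have hprod : ∀ (a : ℝ) (ha : a ≠ 0) (e : Fin N → ℤ), ∏ j, a ^ e j = a ^ ∑ j, e j := by
    intro a ha e
    induction (Finset.univ : Finset (Fin N)) using Finset.induction_on with
    | empty => simp
    | insert i s hi ih => rw [Finset.prod_insert hi, Finset.sum_insert hi, ih, zpow_add₀ ha]
  rw [hprod _ hpp.ne', hprod _ hzp.ne', split, split]
  have h4 := sum_tri_add_one_le_coreForm x
  have h5 : ∑ j, tri (x j + 1) = ∑ j, tri (x j) + ∑ j, x j := by
    rw [← Finset.sum_add_distrib]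
    refine Finset.sum_congr rfl fun j _ => ?_
    rw [tri_add]
    simp [tri]
  gcongr ?_ * ?_
  · exact zpow_le_zpow_right_of_le_one₀ (by positivity) ((div_lt_one hzp).mpr hpz).le
      (sum_tri_le_coreForm x)
  · exact zpow_le_zpow_right_of_le_one₀ hzp hz.le (by linarith)

lemma prod_zpow_eq_zpow_sum {ι : Type*} (s : Finset ι) {a : ℂ} (ha : a ≠ 0) (e : ι → ℤ) :
    ∏ j ∈ s, a ^ e j = a ^ ∑ j ∈ s, e j := by
  classical
  induction s using Finset.induction_on with
  | empty => simp
  | insert i s hi ih => rw [Finset.prod_insert hi, Finset.sum_insert hi, ih, zpow_add₀ ha]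

lemma sum_fin_val_add_one (N : ℕ) : ∑ j : Fin N, ((j : ℤ) + 1) = tri (N + 1) := by
  induction N with
  | zero => simp [tri]
  | succ N ih =>
    rw [Fin.sum_univ_castSucc]
    simp only [Fin.val_castSucc, Fin.val_last, ih]
    push_cast
    linarith [two_mul_tri ((N : ℤ) + 1), two_mul_tri ((N : ℤ) + 1 + 1)]

/-- The lattice sum `∑ p ^ coreForm x z ^ (∑ x)`. -/
noncomputable def coreSeries (N : ℕ) (p z : ℂ) : ℂ :=
  ∑' x : Fin N → ℤ, p ^ coreForm x * z ^ ∑ j, x j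

/-- The coefficient of `z ^ k` in `coreSeries N p z * thetaSeries p (-z)`. -/
noncomputable def coreThetaCoeff (N : ℕ) (p : ℂ) (k : ℤ) : ℂ :=
  (-1) ^ k * p ^ tri k * ∏ j : Fin N, thetaSeries (p ^ (N + 1)) (-p ^ ((j : ℤ) + 1 - k))

lemma coreForm_add_tri {N : ℕ} (x : Fin N → ℤ) (k : ℤ) :
    coreForm x + tri (k - ∑ j, x j) =
      tri k + ∑ j, (((N + 1 : ℕ) : ℤ) * tri (x j) + ((j : ℤ) + 1 - k) * x j) := by
  have h1 : ∑ j, (((N + 1 : ℕ) : ℤ) * tri (x j) + ((j : ℤ) + 1 - k) * x j) =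
      ∑ j, ((N + 1) * tri (x j) + (j + 1) * x j) - k * ∑ j, x j := by
    rw [Finset.mul_sum, ← Finset.sum_sub_distrib]
    refine Finset.sum_congr rfl fun j _ => ?_
    push_cast
    ring
  rw [h1, coreForm]
  set s := ∑ j, x j
  linarith [two_mul_tri (-s), two_mul_tri (k - s), two_mul_tri k]

lemma coreSeries_mul_thetaSeries_eq_tsum {N : ℕ} {p z : ℂ} (hp0 : p ≠ 0) (hpz : ‖p‖ < ‖z‖)
    (hz : ‖z‖ < 1) :
    coreSeries N p z * thetaSeries p (-z) = ∑' k : ℤ, coreThetaCoeff N p k * z ^ k := by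
  have hz0 : z ≠ 0 := norm_pos_iff.mp ((norm_nonneg p).trans_lt hpz)
  have hp : ‖p‖ < 1 := hpz.trans hz
  have hs1 := summable_norm_coreForm (N := N) hp0 hpz hz
  have hs2 := summable_norm_theta hp0 hp (neg_ne_zero.mpr hz0)
  let σ : ℤ × (Fin N → ℤ) ≃ (Fin N → ℤ) × ℤ :=
    { toFun := fun a => (a.2, a.1 - ∑ j, a.2 j)
      invFun := fun b => (b.2 + ∑ j, b.1 j, b.1)
      left_inv := fun a => by simp
      right_inv := fun b => by simp }
  have hs := (summable_mul_of_summable_norm hs1 hs2)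
  have hσ : Summable fun a : ℤ × (Fin N → ℤ) =>
      (p ^ coreForm (σ a).1 * z ^ ∑ j, (σ a).1 j) * (p ^ tri (σ a).2 * (-z) ^ (σ a).2) :=
    σ.summable_iff.mpr hs
  rw [coreSeries, thetaSeries, tsum_mul_tsum_of_summable_norm hs1 hs2, ← σ.tsum_eq,
    hσ.tsum_prod]
  refine tsum_congr fun k => ?_
  have hP0 : p ^ (N + 1) ≠ 0 := pow_ne_zero _ hp0
  have hP : ‖p ^ (N + 1)‖ < 1 := norm_pow_lt_one hp N.succ_pos
  have hpi := (summable_norm_prod_pi (N := N)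
    (f := fun j y => (p ^ (N + 1)) ^ tri y * (-p ^ ((j : ℤ) + 1 - k)) ^ y) fun j =>
      summable_norm_theta hP0 hP (neg_ne_zero.mpr (zpow_ne_zero _ hp0))).2
  simp only [coreThetaCoeff, thetaSeries]
  rw [← hpi, ← tsum_mul_left, ← tsum_mul_right]
  refine tsum_congr fun x => ?_
  change p ^ coreForm x * z ^ (∑ j, x j) *
    (p ^ tri (k - ∑ j, x j) * (-z) ^ (k - ∑ j, x j)) = _
  have h1 : ∀ j : Fin N, (p ^ (N + 1)) ^ tri (x j) * (-p ^ ((j : ℤ) + 1 - k)) ^ x j =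
      p ^ (((N + 1 : ℕ) : ℤ) * tri (x j) + ((j : ℤ) + 1 - k) * x j) * (-1) ^ x j := by
    intro j
    rw [neg_eq_neg_one_mul, mul_zpow, ← zpow_mul, zpow_add₀ hp0, zpow_mul p _ (tri _), zpow_natCast]
    ring
  simp_rw [h1]
  rw [Finset.prod_mul_distrib, prod_zpow_eq_zpow_sum _ hp0,
    prod_zpow_eq_zpow_sum _ (neg_ne_zero.mpr one_ne_zero)]
  have h2 : p ^ coreForm x * p ^ tri (k - ∑ j, x j) = p ^ tri k *
      p ^ ∑ j, (((N + 1 : ℕ) : ℤ) * tri (x j) + ((j : ℤ) + 1 - k) * x j) := by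
    rw [← zpow_add₀ hp0, coreForm_add_tri, zpow_add₀ hp0]
  set s := ∑ j, x j
  have h3 : (-z) ^ (k - s) * z ^ s = (-1) ^ k * (-1) ^ s * z ^ k := by
    rw [neg_eq_neg_one_mul z, mul_zpow, mul_assoc, ← zpow_add₀ hz0, sub_add_cancel,
      zpow_sub₀ (by norm_num)]
    rcases Int.even_or_odd s with hs | hs <;> simp [hs.neg_one_zpow, div_neg]
  calc _ = (p ^ coreForm x * p ^ tri (k - s)) * ((-z) ^ (k - s) * z ^ s) := by ring
    _ = _ := by rw [h2, h3]; ring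

lemma coreThetaCoeff_eq_zero {N : ℕ} {p : ℂ} (hp0 : p ≠ 0) {k : ℤ} (hk : ¬ ((N + 1 : ℕ) : ℤ) ∣ k) :
    coreThetaCoeff N p k = 0 := by
  have hpos : (0 : ℤ) < ((N + 1 : ℕ) : ℤ) := by positivity
  have h1 := Int.emod_nonneg k hpos.ne'
  have h2 := Int.emod_lt_of_pos k hpos
  have h3 : k % ((N + 1 : ℕ) : ℤ) ≠ 0 := fun h => hk (Int.dvd_of_emod_eq_zero h)
  have h4 := Int.emod_add_mul_ediv k ((N + 1 : ℕ) : ℤ)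
  set r := k % ((N + 1 : ℕ) : ℤ)
  set l := k / ((N + 1 : ℕ) : ℤ)
  rw [coreThetaCoeff]
  refine mul_eq_zero_of_right _
    (Finset.prod_eq_zero (Finset.mem_univ (⟨(r - 1).toNat, by omega⟩ : Fin N)) ?_)
  have h5 : (((r - 1).toNat : ℕ) : ℤ) + 1 - k = ((N + 1 : ℕ) : ℤ) * (-l) := by
    rw [Int.toNat_of_nonneg (by omega)]
    linarith
  simp only [h5]
  rw [zpow_mul, zpow_natCast]
  exact thetaSeries_neg_zpow_eq_zero (pow_ne_zero _ hp0) _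

lemma coreThetaCoeff_mul {N : ℕ} {p : ℂ} (hp0 : p ≠ 0) (l : ℤ) :
    coreThetaCoeff N p ((N + 1 : ℕ) * l) =
      coreThetaCoeff N p 0 * ((-1) ^ l * (p ^ (N + 1)) ^ tri l) := by
  have hP0 : p ^ (N + 1) ≠ 0 := pow_ne_zero _ hp0
  have h1 : ∀ j : Fin N, thetaSeries (p ^ (N + 1)) (-p ^ ((j : ℤ) + 1 - (N + 1 : ℕ) * l)) =
      (-1) ^ l * p ^ (((j : ℤ) + 1) * l) * p ^ (-((N + 1 : ℕ) * tri (l + 1)) : ℤ) *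
        thetaSeries (p ^ (N + 1)) (-p ^ ((j : ℤ) + 1)) := by
    intro j
    have h2 : -p ^ ((j : ℤ) + 1 - (N + 1 : ℕ) * l) =
        (-p ^ ((j : ℤ) + 1)) * (p ^ (N + 1)) ^ (-l) := by
      rw [sub_eq_add_neg, zpow_add₀ hp0, ← mul_neg ((N + 1 : ℕ) : ℤ), zpow_mul p, zpow_natCast,
        neg_mul]
    rw [h2, thetaSeries_mul_zpow hP0 (neg_ne_zero.mpr (zpow_ne_zero _ hp0)),
      neg_eq_neg_one_mul (p ^ ((j : ℤ) + 1)), mul_zpow, ← zpow_mul, ← mul_neg, zpow_mul p _ (-_),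
      zpow_natCast]
  simp only [coreThetaCoeff, h1, sub_zero]
  rw [Finset.prod_mul_distrib, Finset.prod_mul_distrib, Finset.prod_mul_distrib,
    prod_zpow_eq_zpow_sum _ hp0, prod_zpow_eq_zpow_sum _ hp0,
    prod_zpow_eq_zpow_sum _ (neg_ne_zero.mpr one_ne_zero), ← Finset.sum_mul, sum_fin_val_add_one]
  simp only [Finset.sum_const, Finset.card_univ, Fintype.card_fin, nsmul_eq_mul]
  have h3 : tri ((N + 1 : ℕ) * l) + tri (N + 1) * l + N * -((N + 1 : ℕ) * tri (l + 1)) =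
      (N + 1 : ℕ) * tri l := by
    have a1 := two_mul_tri ((N + 1 : ℕ) * l)
    have a2 := congrArg (· * l) (two_mul_tri ((N : ℤ) + 1))
    have a3 := congrArg (((N : ℤ) * (N + 1)) * ·) (two_mul_tri (l + 1))
    have a4 := congrArg (((N : ℤ) + 1) * ·) (two_mul_tri l)
    push_cast at *
    linarith
  have h4 : p ^ tri ((N + 1 : ℕ) * l) * p ^ (tri (N + 1) * l) *
      p ^ ((N : ℤ) * -((N + 1 : ℕ) * tri (l + 1))) = (p ^ (N + 1)) ^ tri l := by
    rw [← zpow_add₀ hp0, ← zpow_add₀ hp0, h3, zpow_mul, zpow_natCast]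
  have h5 : (-1 : ℂ) ^ (((N + 1 : ℕ) : ℤ) * l) * (-1) ^ ((N : ℤ) * l) = (-1) ^ l := by
    rw [← zpow_add₀ (by norm_num), show ((N + 1 : ℕ) : ℤ) * l + N * l = 2 * (N * l) + l by
      push_cast; ring, zpow_add₀ (by norm_num), zpow_mul]
    norm_num
  rw [← h4, ← h5]
  simp [tri]
  ring

lemma coreThetaCoeff_zero {N : ℕ} {p : ℂ} (hp0 : p ≠ 0) (hp : ‖p‖ < 1) :
    coreThetaCoeff N p 0 * Eprod (p ^ (N + 1)) ^ 2 =
      Eprod p ^ 2 * Eprod (p ^ (N + 1)) ^ N := by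
  have hP0 : p ^ (N + 1) ≠ 0 := pow_ne_zero _ hp0
  have hP : ‖p ^ (N + 1)‖ < 1 := norm_pow_lt_one hp N.succ_pos
  have h1 : ∀ j : Fin N, thetaSeries (p ^ (N + 1)) (-p ^ ((j : ℤ) + 1 - 0)) =
      Eprod (p ^ (N + 1)) * (qPoch (p ^ ((j : ℕ) + 1)) (p ^ (N + 1)) *
        qPoch (p ^ ((j.rev : ℕ) + 1)) (p ^ (N + 1))) := by
    intro j
    rw [sub_zero, thetaSeries_neg hP0 hP (zpow_ne_zero _ hp0)]
    congr 3
    rw [Fin.val_rev, ← zpow_neg, ← zpow_natCast, ← zpow_natCast, ← zpow_add₀ hp0]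
    congr 1
    omega
  have h2 := prod_qPoch_mul_Eprod hp N
  rw [Finset.prod_range] at h2
  have h3 := Equiv.prod_comp Fin.revPerm fun j : Fin N => qPoch (p ^ ((j : ℕ) + 1)) (p ^ (N + 1))
  simp only [Fin.revPerm_apply] at h3
  simp only [coreThetaCoeff, h1]
  rw [Finset.prod_mul_distrib, Finset.prod_mul_distrib, h3, ← h2]
  simp [tri]
  ring

/-- The `z`-analogue of Klyachko's identity. -/
theorem coreSeries_mul_qPoch {N : ℕ} {p z : ℂ} (hp0 : p ≠ 0) (hpz : ‖p‖ < ‖z‖)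
    (hz : ‖z‖ < 1) :
    coreSeries N p z * Eprod (p ^ (N + 1)) ^ 2 * (qPoch z p * qPoch (z⁻¹ * p) p) =
      Eprod p * Eprod (p ^ (N + 1)) ^ (N + 1) *
        (qPoch (z ^ (N + 1)) (p ^ (N + 1)) *
          qPoch ((z ^ (N + 1))⁻¹ * p ^ (N + 1)) (p ^ (N + 1))) := by
  have hz0 : z ≠ 0 := norm_pos_iff.mp ((norm_nonneg p).trans_lt hpz)
  have hp : ‖p‖ < 1 := hpz.trans hz
  have hP0 : p ^ (N + 1) ≠ 0 := pow_ne_zero _ hp0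
  have hP : ‖p ^ (N + 1)‖ < 1 := norm_pow_lt_one hp N.succ_pos
  have h1 := coreSeries_mul_thetaSeries_eq_tsum (N := N) hp0 hpz hz
  have hinj : Function.Injective fun l : ℤ => ((N + 1 : ℕ) : ℤ) * l :=
    mul_right_injective₀ (by positivity)
  have h2 : ∑' k : ℤ, coreThetaCoeff N p k * z ^ k =
      coreThetaCoeff N p 0 * thetaSeries (p ^ (N + 1)) (-z ^ (N + 1)) := by
    rw [← hinj.tsum_eq, thetaSeries, ← tsum_mul_left]
    · refine tsum_congr fun l => ?_
      rw [coreThetaCoeff_mul hp0, neg_eq_neg_one_mul (z ^ (N + 1)), mul_zpow, zpow_mul,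
        zpow_natCast]
      ring
    · intro k hk
      by_contra h
      refine hk (mul_eq_zero_of_left (coreThetaCoeff_eq_zero hp0 fun ⟨l, hl⟩ => h ⟨l, hl.symm⟩) _)
  rw [h2, thetaSeries_neg hp0 hp hz0, thetaSeries_neg hP0 hP (pow_ne_zero _ hz0)] at h1
  apply mul_left_cancel₀ (Eprod_ne_zero hp)
  have h3 := coreThetaCoeff_zero (N := N) hp0 hp
  linear_combination Eprod (p ^ (N + 1)) ^ 2 * h1 +
    Eprod (p ^ (N + 1)) * (qPoch (z ^ (N + 1)) (p ^ (N + 1)) *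
          qPoch ((z ^ (N + 1))⁻¹ * p ^ (N + 1)) (p ^ (N + 1))) * h3

/-- `F` is given on the unit disc by a power series with nonnegative real coefficients. -/
def HasNonnegSeries (F : ℂ → ℂ) : Prop :=
  ∃ c : ℕ → ℝ, (∀ j, 0 ≤ c j) ∧ ∀ q : ℂ, ‖q‖ < 1 →
    (Summable fun j => ‖(c j : ℂ) * q ^ j‖) ∧ F q = ∑' j : ℕ, (c j : ℂ) * q ^ j

lemma HasNonnegSeries.one : HasNonnegSeries fun _ => 1 := by
  refine ⟨fun j => if j = 0 then 1 else 0, fun j => by dsimp only; split_ifs <;> simp, fun q _ => ⟨?_, ?_⟩⟩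
  · refine summable_of_ne_finset_zero (s := {0}) fun j hj => ?_
    simp at hj
    simp [hj]
  · rw [tsum_eq_single 0 fun j hj => by simp [hj]]
    simp

lemma HasNonnegSeries.mul {F G : ℂ → ℂ} (hF : HasNonnegSeries F) (hG : HasNonnegSeries G) :
    HasNonnegSeries fun q => F q * G q := by
  obtain ⟨a, ha, hF⟩ := hF
  obtain ⟨b, hb, hG⟩ := hG
  refine ⟨fun n => ∑ k ∈ Finset.HasAntidiagonal.antidiagonal n, a k.1 * b k.2,
    fun n => Finset.sum_nonneg fun k _ => mul_nonneg (ha _) (hb _), fun q hq => ?_⟩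
  obtain ⟨hFs, hFq⟩ := hF q hq
  obtain ⟨hGs, hGq⟩ := hG q hq
  have h : ∀ n, ((∑ k ∈ Finset.HasAntidiagonal.antidiagonal n, a k.1 * b k.2 : ℝ) : ℂ) * q ^ n =
      ∑ k ∈ Finset.HasAntidiagonal.antidiagonal n, ((a k.1 : ℂ) * q ^ k.1) * ((b k.2 : ℂ) * q ^ k.2) := by
    intro n
    push_cast
    rw [Finset.sum_mul]
    refine Finset.sum_congr rfl fun k hk => ?_
    rw [← Finset.HasAntidiagonal.mem_antidiagonal.mp hk, pow_add]
    ring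
  refine ⟨(summable_norm_sum_mul_antidiagonal_of_summable_norm hFs hGs).congr fun n => ?_, ?_⟩
  · exact congrArg norm (h n).symm
  · dsimp only
    rw [hFq, hGq, tsum_mul_tsum_eq_tsum_sum_antidiagonal_of_summable_norm hFs hGs]
    exact tsum_congr fun n => (h n).symm

lemma HasNonnegSeries.prod {ι : Type*} (s : Finset ι) {F : ι → ℂ → ℂ}
    (hF : ∀ i ∈ s, HasNonnegSeries (F i)) : HasNonnegSeries fun q => ∏ i ∈ s, F i q := by
  classical
  induction s using Finset.induction_on with
  | empty => simpa using HasNonnegSeries.one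
  | insert i s hi ih =>
    simp_rw [Finset.prod_insert hi]
    exact (hF i (Finset.mem_insert_self i s)).mul
      (ih fun j hj => hF j (Finset.mem_insert_of_mem hj))

lemma HasNonnegSeries.tsum_pow {ι : Type*} {e : ι → ℕ}
    (he : ∀ t : ℝ, 0 < t → t < 1 → Summable fun i => t ^ e i) :
    HasNonnegSeries fun q => ∑' i, q ^ e i := by
  have hs : ∀ q : ℂ, ‖q‖ < 1 → Summable fun i => ‖q ^ e i‖ := by
    intro q hq
    refine Summable.of_nonneg_of_le (fun _ => norm_nonneg _) (fun i => ?_)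
      (he (max ‖q‖ 2⁻¹) (by positivity) (max_lt hq (by norm_num)))
    rw [norm_pow]
    gcongr
    exact le_max_left _ _
  refine ⟨fun j => Nat.card {i // e i = j}, fun j => Nat.cast_nonneg _, fun q hq => ?_⟩
  have h1 := (Equiv.sigmaFiberEquiv e).summable_iff.mpr (hs q hq)
  have h2 : Summable fun x => q ^ e (Equiv.sigmaFiberEquiv e x) :=
    (Equiv.sigmaFiberEquiv e).summable_iff.mpr (hs q hq).of_norm
  have h3 : ∀ (j : ℕ) (x : {i // e i = j}), q ^ e (Equiv.sigmaFiberEquiv e ⟨j, x⟩) = q ^ j := by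
    rintro j ⟨i, rfl⟩
    rfl
  constructor
  · refine h1.sigma.congr fun j => ?_
    simp only [Function.comp_apply, h3, tsum_const, nsmul_eq_mul, norm_mul]
    simp
  · dsimp only
    rw [← (Equiv.sigmaFiberEquiv e).tsum_eq, h2.tsum_sigma]
    refine tsum_congr fun j => ?_
    simp only [h3, tsum_const, nsmul_eq_mul]
    simp

/-- The exponent of `q` in the lattice sum `coreSeries N (q ^ m) (q ^ r)`. -/
def coreExponent {N : ℕ} (m r : ℕ) (x : Fin N → ℤ) : ℕ :=
  (m * coreForm x + r * ∑ j, x j).toNat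

lemma coreExponent_cast {N m r : ℕ} (hr : r ≤ m) (x : Fin N → ℤ) :
    (coreExponent m r x : ℤ) = m * coreForm x + r * ∑ j, x j := by
  refine Int.toNat_of_nonneg ?_
  obtain ⟨d, rfl⟩ := Nat.exists_eq_add_of_le hr
  have h1 := mul_nonneg (Int.natCast_nonneg d) (coreForm_nonneg x)
  have h2 := mul_nonneg (Int.natCast_nonneg r) (coreForm_add_sum_nonneg x)
  push_cast
  linarith

lemma coreExponent_eq_zero_iff {N m r : ℕ} (hr0 : 0 < r) (hr : r < m) (x : Fin N → ℤ) :
    coreExponent m r x = 0 ↔ x = 0 := by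
  constructor
  · intro h
    have h0 := coreExponent_cast hr.le x
    rw [h] at h0
    obtain ⟨d, rfl⟩ := Nat.exists_eq_add_of_lt hr
    have h1 := coreForm_nonneg x
    have h2 := coreForm_add_sum_nonneg x
    have hd : (0 : ℤ) < (d + 1 : ℕ) := by positivity
    have hr' : (0 : ℤ) < r := by exact_mod_cast hr0
    have h3 : ((d + 1 : ℕ) : ℤ) * coreForm x + r * (coreForm x + ∑ j, x j) = 0 := by
      push_cast at *
      linarith
    have h4 := mul_nonneg hd.le h1
    have h5 := mul_nonneg hr'.le h2
    exact eq_zero_of_coreForm_eq_zero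
      ((mul_eq_zero.mp (by linarith : ((d + 1 : ℕ) : ℤ) * coreForm x = 0)).resolve_left hd.ne')
      ((mul_eq_zero.mp (by linarith : (r : ℤ) * (coreForm x + ∑ j, x j) = 0)).resolve_left hr'.ne')
  · rintro rfl
    simp [coreExponent, coreForm, tri]

lemma pow_coreExponent {N m r : ℕ} (hr : r ≤ m) {q : ℂ} (hq0 : q ≠ 0) (x : Fin N → ℤ) :
    q ^ coreExponent m r x = (q ^ m) ^ coreForm x * (q ^ r) ^ ∑ j, x j := by
  rw [← zpow_natCast, coreExponent_cast hr, zpow_add₀ hq0, zpow_mul, zpow_mul, zpow_natCast,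
    zpow_natCast]

lemma norm_pow_lt_norm_pow {q : ℂ} (hq0 : q ≠ 0) (hq : ‖q‖ < 1) {r m : ℕ} (hr : r < m) :
    ‖q ^ m‖ < ‖q ^ r‖ := by
  rw [norm_pow, norm_pow]
  exact pow_lt_pow_right_of_lt_one₀ (norm_pos_iff.mpr hq0) hq hr

lemma hasNonnegSeries_core (N : ℕ) {m r : ℕ} (hr0 : 0 < r) (hr : r < m) :
    HasNonnegSeries fun q => ∑' x : Fin N → ℤ, q ^ coreExponent m r x := by
  refine HasNonnegSeries.tsum_pow fun t ht0 ht1 => ?_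
  have hq0 : (t : ℂ) ≠ 0 := by exact_mod_cast ht0.ne'
  have hq : ‖(t : ℂ)‖ < 1 := by simpa [abs_of_pos ht0] using ht1
  refine (summable_norm_coreForm (N := N) (pow_ne_zero m hq0) (norm_pow_lt_norm_pow hq0 hq hr)
    (norm_pow_lt_one hq hr0)).congr fun x => ?_
  rw [← pow_coreExponent hr.le hq0]
  simp [abs_of_pos ht0]

lemma prod_qPoch_pair_mul_Eprod {q : ℂ} (hq0 : q ≠ 0) (hq : ‖q‖ < 1) (h : ℕ) :
    (∏ r ∈ Finset.range h, (qPoch (q ^ (r + 1)) (q ^ (2 * h + 1)) *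
      qPoch ((q ^ (r + 1))⁻¹ * q ^ (2 * h + 1)) (q ^ (2 * h + 1)))) * Eprod (q ^ (2 * h + 1)) =
      Eprod q := by
  rw [← prod_qPoch_mul_Eprod hq (2 * h), Finset.prod_mul_distrib, show Finset.range (2 * h) =
    Finset.range (h + h) by rw [two_mul], Finset.prod_range_add _ h h]
  congr 2
  rw [← Finset.prod_range_reflect]
  refine Finset.prod_congr rfl fun r hr => ?_
  have hr' : r < h := by simpa using hr
  congr 1
  rw [inv_mul_eq_iff_eq_mul₀ (pow_ne_zero _ hq0), ← pow_add]
  congr 1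
  omega

lemma prod_coreSeries_eq {q : ℂ} (hq0 : q ≠ 0) (hq : ‖q‖ < 1) (h N : ℕ) :
    Eprod (q ^ ((2 * h + 1) * (N + 1))) ^ ((((N + 1) * h : ℕ) : ℤ) - ((2 * h + 1 : ℕ) : ℤ)) *
      Eprod (q ^ (2 * h + 1)) ^ (h + 1) * Eprod (q ^ (N + 1)) / Eprod q =
      ∏ r ∈ Finset.range h, coreSeries N (q ^ (2 * h + 1)) (q ^ (r + 1)) := by
  have hX := prod_qPoch_pair_mul_Eprod hq0 hq h
  have hY := prod_qPoch_pair_mul_Eprod (pow_ne_zero (N + 1) hq0)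
    (norm_pow_lt_one hq N.succ_pos) h
  have hP := Finset.prod_congr rfl fun r (hr : r ∈ Finset.range h) =>
    coreSeries_mul_qPoch (N := N) (p := q ^ (2 * h + 1)) (z := q ^ (r + 1)) (pow_ne_zero _ hq0)
      (norm_pow_lt_norm_pow hq0 hq (by have := Finset.mem_range.mp hr; omega))
      (norm_pow_lt_one hq r.succ_pos)
  have hc : ∀ a : ℕ, (q ^ a) ^ (N + 1) = (q ^ (N + 1)) ^ a := fun a => pow_right_comm q a (N + 1)
  simp only [hc, Finset.prod_mul_distrib, Finset.prod_const, Finset.card_range] at hP hX hY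
  have ha : Eprod ((q ^ (N + 1)) ^ (2 * h + 1)) ≠ 0 :=
    Eprod_ne_zero (norm_pow_lt_one (norm_pow_lt_one hq N.succ_pos) (by omega))
  rw [pow_mul, hc, div_eq_iff (Eprod_ne_zero hq), zpow_sub₀ ha, zpow_natCast, zpow_natCast,
    div_mul_eq_mul_div, div_mul_eq_mul_div, div_eq_iff (pow_ne_zero _ ha), ← hX, ← hY]
  rw [← pow_mul (Eprod _) (N + 1) h] at hP
  rw [pow_succ (Eprod _) (2 * h), pow_succ (Eprod _) h]
  linear_combination (-(Eprod (q ^ (2 * h + 1)) * Eprod ((q ^ (N + 1)) ^ (2 * h + 1)))) * hP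

/-- If `n` is a positive integer and `m` is a positive odd integer, then
`E(q^{mn})^{n(m-1)/2 - m} E(q^m)^{(m+1)/2} E(q^n) / E(q)`
has nonnegative coefficients. -/
theorem eta_quotient_nonneg_odd (m n : ℕ) (hm : 0 < m) (hmodd : Odd m)
    (hn : 0 < n) :
    ∃ c : ℕ → ℝ, (∀ j, 0 ≤ c j) ∧
      ∀ q : ℂ, ‖q‖ < 1 →
        Eprod (q ^ (m * n)) ^ (((n * ((m - 1) / 2) : ℕ) : ℤ) - (m : ℤ)) *
            Eprod (q ^ m) ^ ((m + 1) / 2) * Eprod (q ^ n) / Eprod q =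
          ∑' j : ℕ, (c j : ℂ) * q ^ j := by
  obtain ⟨h, rfl⟩ := hmodd
  obtain ⟨N, rfl⟩ : ∃ N, n = N + 1 := ⟨n - 1, by omega⟩
  obtain ⟨c, hc, hF⟩ := HasNonnegSeries.prod (Finset.range h) fun r hr =>
    hasNonnegSeries_core N (m := 2 * h + 1) r.succ_pos
      (by have := Finset.mem_range.mp hr; omega)
  refine ⟨c, hc, fun q hq => ?_⟩
  rw [← (hF q hq).2, show (2 * h + 1 - 1) / 2 = h by omega,
    show (2 * h + 1 + 1) / 2 = h + 1 by omega]
  rcases eq_or_ne q 0 with rfl | hq0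
  · have hE : Eprod 0 = 1 := by simp [Eprod]
    rw [zero_pow (by positivity), zero_pow (by positivity), zero_pow (by positivity), hE]
    dsimp only
    rw [Finset.prod_eq_one]
    · simp
    · intro r hr
      have hr' : r + 1 < 2 * h + 1 := by have := Finset.mem_range.mp hr; omega
      rw [tsum_eq_single 0]
      · rw [(coreExponent_eq_zero_iff r.succ_pos hr' _).mpr rfl, pow_zero]
      · intro x hx
        exact zero_pow fun h0 => hx ((coreExponent_eq_zero_iff r.succ_pos hr' x).mp h0)
  · rw [prod_coreSeries_eq hq0 hq]
    refine Finset.prod_congr rfl fun r hr => tsum_congr fun x => ?_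
    rw [pow_coreExponent (by have := Finset.mem_range.mp hr; omega) hq0]
end

section
/- For |q| < 1 and z ≠ 0 avoiding poles: E(q²)·[z;q²]_∞/[z;q]_∞ = E(q²)/[zq;q²]_∞, and consequently E(q²)·[z;q²]_∞/[z;q]_∞ has nonnegative coefficients; moreover E(q³)·[z²;q³]_∞/[z;q]_∞ factors as ((1-z²)E(q³)/[z;q³]_∞) · ((z²q³;q³)_∞/((zq;q³)_∞(zq²;q³)_∞)) · ((q³/z²;q³)_∞/((q/z;q³)_∞(q²/z;q³)_∞)) and has nonnegative coefficients. -/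
/-- `(x;q)_∞ = ∏_{j ≥ 0} (1 - x qʲ)`. -/
noncomputable def poch (x q : ℂ) : ℂ := ∏' j : ℕ, (1 - x * q ^ j)

/-- `[z;q]_∞ = ∏_{n ≥ 1} (1 - z q^{n-1})(1 - z⁻¹ qⁿ)`. -/
noncomputable def brkt (z q : ℂ) : ℂ := ∏' n : ℕ, (1 - z * q ^ n) * (1 - z⁻¹ * q ^ (n + 1))

open Filter Topology Finset

section Pochhammer

variable {x q : ℂ}

lemma norm_pow_lt_one_s19 (hq : ‖q‖ < 1) {m : ℕ} (hm : m ≠ 0) : ‖q ^ m‖ < 1 := by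
  rw [norm_pow]
  exact pow_lt_one₀ (norm_nonneg q) hq hm

lemma summable_norm_neg_mul_pow (x : ℂ) (hq : ‖q‖ < 1) :
    Summable fun j : ℕ => ‖-(x * q ^ j)‖ := by
  simpa using (summable_geometric_of_lt_one (norm_nonneg q) hq).mul_left ‖x‖

lemma multipliable_poch (x : ℂ) (hq : ‖q‖ < 1) :
    Multipliable fun j : ℕ => 1 - x * q ^ j := by
  simpa [sub_eq_add_neg] using
    multipliable_one_add_of_summable (summable_norm_neg_mul_pow x hq)

lemma tendsto_prod_poch (x : ℂ) (hq : ‖q‖ < 1) :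
    Tendsto (fun n => ∏ j ∈ range n, (1 - x * q ^ j)) atTop (𝓝 (poch x q)) :=
  (multipliable_poch x hq).hasProd.tendsto_prod_nat

lemma mul_pow_ne_one (hx : ‖x‖ < 1) (hq : ‖q‖ < 1) (j : ℕ) : x * q ^ j ≠ 1 := by
  intro h
  have h1 : ‖x‖ * ‖q‖ ^ j = 1 := by simpa using congrArg norm h
  have := mul_le_of_le_one_right (norm_nonneg x) (pow_le_one₀ (n := j) (norm_nonneg q) hq.le)
  linarith

lemma poch_ne_zero (hx : ‖x‖ < 1) (hq : ‖q‖ < 1) : poch x q ≠ 0 := by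
  have h := tprod_one_add_ne_zero_of_summable (f := fun j : ℕ => -(x * q ^ j))
    (fun j => by
      rw [← sub_eq_add_neg]
      exact sub_ne_zero.2 (mul_pow_ne_one hx hq j).symm) (summable_norm_neg_mul_pow x hq)
  simpa [poch, sub_eq_add_neg] using h

lemma Eprod_eq_poch (q : ℂ) : Eprod q = poch q q := by
  simp only [Eprod, poch, pow_succ']

lemma poch_eq_one_sub_mul (x : ℂ) (hq : ‖q‖ < 1) : poch x q = (1 - x) * poch (x * q) q := by
  have h := tprod_eq_zero_mul' (f := fun j : ℕ => 1 - x * q ^ j) (by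
    simpa only [pow_succ', ← mul_assoc] using multipliable_poch (x * q) hq)
  simpa only [poch, pow_zero, mul_one, pow_succ', ← mul_assoc] using h

lemma poch_eq_prod_mul (x : ℂ) (hq : ‖q‖ < 1) (n : ℕ) :
    poch x q = (∏ j ∈ range n, (1 - x * q ^ j)) * poch (x * q ^ n) q := by
  induction n with
  | zero => simp
  | succ n ih => rw [ih, prod_range_succ, poch_eq_one_sub_mul (x * q ^ n) hq, pow_succ]; ring_nf

lemma brkt_eq_poch_mul (z : ℂ) (hq : ‖q‖ < 1) : brkt z q = poch z q * poch (q / z) q := by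
  have h (n : ℕ) : z⁻¹ * q ^ (n + 1) = q / z * q ^ n := by rw [pow_succ']; ring
  simp only [brkt, h]
  exact (multipliable_poch z hq).tprod_mul (multipliable_poch (q / z) hq)

/-- Splitting `(x;q)_∞` according to residues of the index modulo `m`. -/
lemma poch_eq_prod_poch_pow (x : ℂ) (hq : ‖q‖ < 1) {m : ℕ} (hm : m ≠ 0) :
    poch x q = ∏ r ∈ range m, poch (x * q ^ r) (q ^ m) := by
  have hqm := norm_pow_lt_one_s19 hq hm
  have hsplit (N : ℕ) : ∏ j ∈ range (m * N), (1 - x * q ^ j) =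
      ∏ r ∈ range m, ∏ j ∈ range N, (1 - x * q ^ r * (q ^ m) ^ j) := by
    induction N with
    | zero => simp
    | succ N ih =>
      rw [mul_add_one, prod_range_add, ih, ← prod_mul_distrib]
      refine prod_congr rfl fun r _ => ?_
      rw [prod_range_succ, ← pow_mul, pow_add]
      ring
  refine tendsto_nhds_unique
    ((tendsto_prod_poch x hq).comp (tendsto_id.const_mul_atTop' (Nat.pos_of_ne_zero hm))) ?_
  simp only [Function.comp_def, id, hsplit]
  exact tendsto_finsetProd _ fun r _ => tendsto_prod_poch _ hqm

end Pochhammer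

section QBinomial

variable {a b q : ℂ}

/-- The coefficient `(b;q)_n / (q;q)_n` of the `q`-binomial series. -/
noncomputable def qBinomialCoeff (b q : ℂ) (n : ℕ) : ℂ :=
  (∏ j ∈ range n, (1 - b * q ^ j)) / ∏ j ∈ range n, (1 - q * q ^ j)

lemma exists_norm_qBinomialCoeff_le (b : ℂ) (hq : ‖q‖ < 1) :
    ∃ M, ∀ n, ‖qBinomialCoeff b q n‖ ≤ M := by
  have h := ((tendsto_prod_poch b hq).div (tendsto_prod_poch q hq)
    (poch_ne_zero hq hq)).norm.bddAbove_range
  obtain ⟨M, hM⟩ := h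
  exact ⟨M, fun n => hM ⟨n, rfl⟩⟩

lemma prod_one_sub_ne_zero (hq : ‖q‖ < 1) (n : ℕ) : ∏ j ∈ range n, (1 - q * q ^ j) ≠ 0 :=
  prod_ne_zero_iff.2 fun j _ => sub_ne_zero.2 (mul_pow_ne_one hq hq j).symm

lemma qBinomialCoeff_succ_mul (b : ℂ) (hq : ‖q‖ < 1) (n : ℕ) :
    qBinomialCoeff b q (n + 1) * (1 - q ^ (n + 1)) = qBinomialCoeff b q n * (1 - b * q ^ n) := by
  have h1 := prod_one_sub_ne_zero hq n
  have h2 : 1 - q * q ^ n ≠ 0 := sub_ne_zero.2 (mul_pow_ne_one hq hq n).symm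
  rw [qBinomialCoeff, qBinomialCoeff, prod_range_succ, prod_range_succ, pow_succ']
  generalize 1 - q * q ^ n = d at h2 ⊢
  field_simp

lemma summable_qBinomialCoeff_mul_pow (b : ℂ) (ha : ‖a‖ < 1) (hq : ‖q‖ < 1) :
    Summable fun n => qBinomialCoeff b q n * a ^ n := by
  obtain ⟨M, hM⟩ := exists_norm_qBinomialCoeff_le b hq
  refine .of_norm_bounded ((summable_geometric_of_lt_one (norm_nonneg a) ha).mul_left M)
    fun n => ?_
  rw [norm_mul, norm_pow]
  gcongr
  exact hM n

lemma one_sub_mul_tsum_qBinomialCoeff (b : ℂ) (ha : ‖a‖ < 1) (hq : ‖q‖ < 1) :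
    (1 - a) * ∑' n, qBinomialCoeff b q n * a ^ n =
      (1 - a * b) * ∑' n, qBinomialCoeff b q n * (a * q) ^ n := by
  have haq : ‖a * q‖ < 1 := by
    rw [norm_mul]; exact mul_lt_one_of_nonneg_of_lt_one_left (norm_nonneg a) ha hq.le
  have h1 := summable_qBinomialCoeff_mul_pow b ha hq
  have h2 := summable_qBinomialCoeff_mul_pow b haq hq
  have hL := (h1.sub h2).tsum_eq_zero_add
  rw [h1.tsum_sub h2] at hL
  have hR : ∑' n, (qBinomialCoeff b q (n + 1) * a ^ (n + 1) -
      qBinomialCoeff b q (n + 1) * (a * q) ^ (n + 1)) =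
      a * (∑' n, qBinomialCoeff b q n * a ^ n -
        b * ∑' n, qBinomialCoeff b q n * (a * q) ^ n) := by
    rw [← tsum_mul_left (a := b), ← h1.tsum_sub (h2.mul_left b), ← tsum_mul_left]
    refine tsum_congr fun n => ?_
    linear_combination a ^ (n + 1) * qBinomialCoeff_succ_mul b hq n
  rw [hR] at hL
  simp only [pow_zero, sub_self, zero_add] at hL
  linear_combination hL

/-- The `q`-binomial theorem. -/
lemma tsum_qBinomialCoeff_mul_pow (b : ℂ) (ha : ‖a‖ < 1) (hq : ‖q‖ < 1) :
    ∑' n, qBinomialCoeff b q n * a ^ n = poch (a * b) q / poch a q := by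
  have haq (N : ℕ) : ‖a * q ^ N‖ < 1 := by
    rw [norm_mul, norm_pow]
    exact mul_lt_one_of_nonneg_of_lt_one_left (norm_nonneg a) ha
      (pow_le_one₀ (norm_nonneg q) hq.le)
  have hiter (N : ℕ) : (∏ j ∈ range N, (1 - a * q ^ j)) * ∑' n, qBinomialCoeff b q n * a ^ n =
      (∏ j ∈ range N, (1 - a * b * q ^ j)) * ∑' n, qBinomialCoeff b q n * (a * q ^ N) ^ n := by
    induction N with
    | zero => simp
    | succ N ih =>
      have h := one_sub_mul_tsum_qBinomialCoeff b (haq N) hq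
      rw [mul_right_comm, mul_assoc a (q ^ N) q, ← pow_succ] at h
      rw [prod_range_succ, prod_range_succ]
      linear_combination (1 - a * q ^ N) * ih + (∏ j ∈ range N, (1 - a * b * q ^ j)) * h
  obtain ⟨M, hM⟩ := exists_norm_qBinomialCoeff_le b hq
  have hlim : Tendsto (fun N : ℕ => ∑' n, qBinomialCoeff b q n * (a * q ^ N) ^ n) atTop
      (𝓝 (∑' n, if n = 0 then 1 else 0)) := by
    refine tendsto_tsum_of_dominated_convergence
      ((summable_geometric_of_lt_one (norm_nonneg a) ha).mul_left M) (fun n => ?_)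
      (.of_forall fun N n => ?_)
    · rcases eq_or_ne n 0 with rfl | hn
      · simp [qBinomialCoeff]
      · have h := (((tendsto_pow_atTop_nhds_zero_of_norm_lt_one hq).const_mul a).pow n).const_mul
          (qBinomialCoeff b q n)
        simpa [hn] using h
    · rw [norm_mul, norm_pow]
      have : ‖a * q ^ N‖ ≤ ‖a‖ := by
        rw [norm_mul, norm_pow]
        exact mul_le_of_le_one_right (norm_nonneg a) (pow_le_one₀ (norm_nonneg q) hq.le)
      gcongr
      · exact (norm_nonneg _).trans (hM n)
      · exact hM n
  have h := tendsto_nhds_unique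
    (((tendsto_prod_poch a hq).mul_const _).congr hiter)
    ((tendsto_prod_poch (a * b) hq).mul hlim)
  rw [eq_div_iff (poch_ne_zero ha hq), mul_comm, h, tsum_ite_eq, mul_one]

/-- Euler's expansion of `1 / (a;q)_∞`. -/
lemma tsum_pow_div_prod (ha : ‖a‖ < 1) (hq : ‖q‖ < 1) :
    ∑' n, a ^ n / ∏ j ∈ range n, (1 - q * q ^ j) = (poch a q)⁻¹ := by
  have h := tsum_qBinomialCoeff_mul_pow 0 ha hq
  have h0 : poch 0 q = 1 := by simp [poch]
  simpa [qBinomialCoeff, h0, div_eq_inv_mul] using h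

/-- A symmetric double series for `(ab;q)_∞ / ((a;q)_∞ (b;q)_∞)`. -/
lemma hasSum_poch_div (ha : ‖a‖ < 1) (hb : ‖b‖ < 1) (hq : ‖q‖ < 1) :
    HasSum (fun p : ℕ × ℕ => a ^ p.1 * b ^ p.2 * q ^ (p.1 * p.2) /
        ((∏ j ∈ range p.1, (1 - q * q ^ j)) * ∏ j ∈ range p.2, (1 - q * q ^ j)))
      (poch (a * b) q / (poch a q * poch b q)) := by
  obtain ⟨M, hM⟩ := exists_norm_qBinomialCoeff_le 0 hq
  have hM' (n : ℕ) : ‖(∏ j ∈ range n, (1 - q * q ^ j))⁻¹‖ ≤ M := by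
    simpa [qBinomialCoeff] using hM n
  have hM0 : 0 ≤ M := (norm_nonneg _).trans (hM 0)
  have hsum : Summable fun p : ℕ × ℕ => a ^ p.1 * b ^ p.2 * q ^ (p.1 * p.2) /
      ((∏ j ∈ range p.1, (1 - q * q ^ j)) * ∏ j ∈ range p.2, (1 - q * q ^ j)) := by
    refine .of_norm_bounded (((summable_geometric_of_lt_one (norm_nonneg a) ha).mul_of_nonneg
      (summable_geometric_of_lt_one (norm_nonneg b) hb) (fun n => by positivity)
      (fun n => by positivity)).mul_right (M * M)) fun p => ?_
    rw [div_eq_mul_inv, mul_inv, norm_mul, norm_mul, norm_mul, norm_mul, norm_pow, norm_pow,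
      norm_pow]
    have hq1 : ‖q‖ ^ (p.1 * p.2) ≤ 1 := pow_le_one₀ (norm_nonneg q) hq.le
    refine mul_le_mul (mul_le_of_le_one_right (by positivity) hq1)
      (mul_le_mul (hM' _) (hM' _) (norm_nonneg _) hM0) (by positivity) (by positivity)
  rw [hsum.hasSum_iff, hsum.tsum_prod]
  have hbq (n : ℕ) : ‖b * q ^ n‖ < 1 := by
    rw [norm_mul, norm_pow]
    exact mul_lt_one_of_nonneg_of_lt_one_left (norm_nonneg b) hb
      (pow_le_one₀ (norm_nonneg q) hq.le)
  have hinner (n : ℕ) : ∑' k, a ^ n * b ^ k * q ^ (n * k) /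
      ((∏ j ∈ range n, (1 - q * q ^ j)) * ∏ j ∈ range k, (1 - q * q ^ j)) =
      qBinomialCoeff b q n * a ^ n * (poch b q)⁻¹ := by
    have h1 : qBinomialCoeff b q n * a ^ n * (poch b q)⁻¹ =
        a ^ n / (∏ j ∈ range n, (1 - q * q ^ j)) * (poch (b * q ^ n) q)⁻¹ := by
      have h2 : ∏ j ∈ range n, (1 - b * q ^ j) ≠ 0 :=
        prod_ne_zero_iff.2 fun j _ => sub_ne_zero.2 (mul_pow_ne_one hb hq j).symm
      have h3 := prod_one_sub_ne_zero hq n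
      have h4 := poch_ne_zero (hbq n) hq
      rw [poch_eq_prod_mul b hq n, qBinomialCoeff]
      field_simp
    rw [h1, ← tsum_pow_div_prod (hbq n) hq, ← tsum_mul_left]
    refine tsum_congr fun k => ?_
    rw [mul_pow, pow_mul, div_mul_div_comm, mul_assoc]
  rw [tsum_congr hinner, tsum_mul_right, tsum_qBinomialCoeff_mul_pow b ha hq]
  rw [div_mul_eq_div_div, div_eq_mul_inv _ (poch b q)]

end QBinomial

section NonnegSeries

/-- On the region `‖q‖ * max ‖z‖ ‖z‖⁻¹ < 1`, `f z q` is the sum of an absolutely convergent series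
of monomials `z ^ i * q ^ n` with `|i| ≤ n + K` and nonnegative real coefficients. -/
def IsNonnegSeries (K : ℕ) (f : ℂ → ℂ → ℂ) : Prop :=
  ∃ (S : Type) (r : S → ℝ) (n : S → ℕ) (i : S → ℤ), (∀ s, 0 ≤ r s) ∧ (∀ s, |i s| ≤ n s + K) ∧
    ∀ z q : ℂ, z ≠ 0 → ‖q‖ * max ‖z‖ ‖z‖⁻¹ < 1 →
      HasSum (fun s => (r s : ℂ) * z ^ i s * q ^ n s) (f z q)

variable {z q : ℂ} {K L : ℕ} {f g : ℂ → ℂ → ℂ}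

lemma norm_mul_lt_one_of_region (h : ‖q‖ * max ‖z‖ ‖z‖⁻¹ < 1) : ‖z * q‖ < 1 := by
  rw [norm_mul, mul_comm]
  exact (mul_le_mul_of_nonneg_left (le_max_left _ _) (norm_nonneg q)).trans_lt h

lemma norm_div_lt_one_of_region (h : ‖q‖ * max ‖z‖ ‖z‖⁻¹ < 1) : ‖q / z‖ < 1 := by
  rw [norm_div, div_eq_mul_inv]
  exact (mul_le_mul_of_nonneg_left (le_max_right _ _) (norm_nonneg q)).trans_lt h

lemma norm_lt_one_of_region (hz : z ≠ 0) (h : ‖q‖ * max ‖z‖ ‖z‖⁻¹ < 1) : ‖q‖ < 1 := by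
  have h1 : 1 ≤ max ‖z‖ ‖z‖⁻¹ := by
    rcases le_total 1 ‖z‖ with h | h
    · exact h.trans (le_max_left _ _)
    · exact ((one_le_inv₀ (norm_pos_iff.2 hz)).2 h).trans (le_max_right _ _)
  exact (le_mul_of_one_le_right (norm_nonneg q) h1).trans_lt h

lemma region_pow (hz : z ≠ 0) (h : ‖q‖ * max ‖z‖ ‖z‖⁻¹ < 1) {m : ℕ} (hm : m ≠ 0) :
    ‖q ^ m‖ * max ‖z‖ ‖z‖⁻¹ < 1 := by
  have hle : ‖q ^ m‖ ≤ ‖q‖ := by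
    rw [norm_pow]
    exact pow_le_of_le_one (norm_nonneg q) (norm_lt_one_of_region hz h).le hm
  exact (mul_le_mul_of_nonneg_right hle (by positivity)).trans_lt h

namespace IsNonnegSeries

lemma congr (hf : IsNonnegSeries K f)
    (h : ∀ z q : ℂ, z ≠ 0 → ‖q‖ * max ‖z‖ ‖z‖⁻¹ < 1 → g z q = f z q) : IsNonnegSeries K g := by
  obtain ⟨S, r, n, i, hr, hi, hs⟩ := hf
  exact ⟨S, r, n, i, hr, hi, fun z q hz hq => by rw [h z q hz hq]; exact hs z q hz hq⟩

lemma mono (hf : IsNonnegSeries K f) (h : K ≤ L) : IsNonnegSeries L f := by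
  obtain ⟨S, r, n, i, hr, hi, hs⟩ := hf
  exact ⟨S, r, n, i, hr, fun s => (hi s).trans (by gcongr), hs⟩

lemma monomial (n : ℕ) (i : ℤ) (h : |i| ≤ n + K) :
    IsNonnegSeries K fun z q => z ^ i * q ^ n :=
  ⟨Unit, fun _ => 1, fun _ => n, fun _ => i, fun _ => zero_le_one, fun _ => h,
    fun z q _ _ => by simp [hasSum_unique]⟩

lemma one : IsNonnegSeries 0 fun _ _ => 1 := by
  simpa using monomial (K := 0) 0 0 (by simp)

lemma mul (hf : IsNonnegSeries K f) (hg : IsNonnegSeries L g) :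
    IsNonnegSeries (K + L) fun z q => f z q * g z q := by
  obtain ⟨S, r, n, i, hr, hi, hs⟩ := hf
  obtain ⟨T, r', n', i', hr', hi', hs'⟩ := hg
  refine ⟨S × T, fun p => r p.1 * r' p.2, fun p => n p.1 + n' p.2, fun p => i p.1 + i' p.2,
    fun p => mul_nonneg (hr _) (hr' _), fun p => ?_, fun z q hz hq => ?_⟩
  · have h1 := hi p.1
    have h2 := hi' p.2
    have := abs_add_le (i p.1) (i' p.2)
    push_cast
    lia
  · have h1 := hs z q hz hq
    have h2 := hs' z q hz hq
    have h3 := summable_mul_of_summable_norm h1.summable.norm h2.summable.norm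
    refine (h1.mul h2 h3).congr_fun fun p => ?_
    rw [zpow_add₀ hz, pow_add]
    push_cast
    ring

lemma pow (hf : IsNonnegSeries 0 f) (n : ℕ) : IsNonnegSeries 0 fun z q => f z q ^ n := by
  induction n with
  | zero => simpa using one
  | succ n ih => simpa only [pow_succ] using ih.mul hf

lemma prod {F : ℕ → ℂ → ℂ → ℂ} (hF : ∀ j, IsNonnegSeries 0 (F j)) (n : ℕ) :
    IsNonnegSeries 0 fun z q => ∏ j ∈ range n, F j z q := by
  induction n with
  | zero => simpa using one
  | succ n ih => simpa only [prod_range_succ] using ih.mul (hF n)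

/-- Nonnegativity makes convergence at `(‖z‖, ‖q‖)` control convergence at `(z, q)`. -/
lemma of_hasSum {ι : Type} {F : ι → ℂ → ℂ → ℂ} (hF : ∀ s, IsNonnegSeries K (F s))
    (h : ∀ z q : ℂ, z ≠ 0 → ‖q‖ * max ‖z‖ ‖z‖⁻¹ < 1 → HasSum (fun s => F s z q) (f z q)) :
    IsNonnegSeries K f := by
  choose S r n i hr hi hs using hF
  refine ⟨Σ s, S s, fun p => r p.1 p.2, fun p => n p.1 p.2, fun p => i p.1 p.2,
    fun p => hr _ _, fun p => hi _ _, fun z q hz hq => ?_⟩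
  have hz' : (‖z‖ : ℂ) ≠ 0 := by simpa using hz
  have hq' : ‖(‖q‖ : ℂ)‖ * max ‖(‖z‖ : ℂ)‖ ‖(‖z‖ : ℂ)‖⁻¹ < 1 := by simpa using hq
  have hin (s : ι) : HasSum (fun t => r s t * ‖z‖ ^ i s t * ‖q‖ ^ n s t)
      (F s ‖z‖ ‖q‖).re := by
    have h := Complex.hasSum_re (hs s _ _ hz' hq')
    convert h using 2 with t
    rw [← Complex.ofReal_zpow, ← Complex.ofReal_pow, ← Complex.ofReal_mul, ← Complex.ofReal_mul,
      Complex.ofReal_re]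
  have hsum : Summable fun p : Σ s, S s => (r p.1 p.2 : ℂ) * z ^ i p.1 p.2 * q ^ n p.1 p.2 := by
    refine .of_norm ((summable_sigma_of_nonneg fun p => norm_nonneg _).2 ?_)
    have hnorm (s : ι) (t : S s) : ‖(r s t : ℂ) * z ^ i s t * q ^ n s t‖ =
        r s t * ‖z‖ ^ i s t * ‖q‖ ^ n s t := by
      simp [abs_of_nonneg (hr s t)]
    simp only [hnorm]
    refine ⟨fun s => (hin s).summable, ?_⟩
    simp only [fun s => (hin s).tsum_eq]
    exact (Complex.hasSum_re (h _ _ hz' hq')).summable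
  have h1 := hsum.hasSum.sigma fun s => hs s z q hz hq
  rw [(h z q hz hq).unique h1]
  exact hsum.hasSum

lemma add (hf : IsNonnegSeries K f) (hg : IsNonnegSeries K g) :
    IsNonnegSeries K fun z q => f z q + g z q := by
  refine of_hasSum (F := fun b : Bool => bif b then g else f) (by rintro (_ | _) <;> assumption)
    fun z q _ _ => ?_
  simpa [add_comm] using hasSum_fintype fun b : Bool => (bif b then g else f) z q

lemma inv_one_sub_pow {m : ℕ} (hm : m ≠ 0) : IsNonnegSeries 0 fun _ q => (1 - q ^ m)⁻¹ := by
  refine of_hasSum (F := fun k _ q => (q ^ m) ^ k)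
    (fun k => .pow (by simpa using monomial (K := 0) m 0 (by simp)) k) fun z q hz hq => ?_
  exact hasSum_geometric_of_norm_lt_one (norm_pow_lt_one_s19 (norm_lt_one_of_region hz hq) hm)

/-- Collecting the monomials of equal exponents. -/
lemma exists_coeff (hf : IsNonnegSeries K f) :
    ∃ c : ℕ → (ℤ →₀ ℝ), (∀ n : ℕ, ∀ i : ℤ, 0 ≤ c n i) ∧
      ∀ z q : ℂ, z ≠ 0 → ‖q‖ * max ‖z‖ ‖z‖⁻¹ < 1 →
        f z q = ∑' n : ℕ, ((c n).sum fun i r => (r : ℂ) * z ^ i) * q ^ n := by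
  obtain ⟨S, r, n, i, hr, hi, hs⟩ := hf
  let e (s : S) : ℕ × ℤ := (n s, i s)
  let d (p : ℕ × ℤ) : ℝ := ∑' s : e ⁻¹' {p}, r s
  have hd (m : ℕ) (j : ℤ) (h : d (m, j) ≠ 0) : j ∈ Icc (-((m : ℤ) + K)) (m + K) := by
    obtain ⟨s, hs⟩ : ∃ s, e s = (m, j) := by
      by_contra! hne
      have : IsEmpty (e ⁻¹' {(m, j)}) := ⟨fun s => hne s s.2⟩
      exact h tsum_empty
    obtain ⟨rfl, rfl⟩ := Prod.mk.inj hs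
    exact mem_Icc.2 (abs_le.1 (hi s))
  refine ⟨fun m => Finsupp.onFinset _ (fun j => d (m, j)) (hd m),
    fun m j => tsum_nonneg fun s => hr s, fun z q hz hq => ?_⟩
  have h1 := (hs z q hz hq).tsum_fiberwise e
  have h2 (p : ℕ × ℤ) : ∑' s : e ⁻¹' {p}, (r s : ℂ) * z ^ i s * q ^ n s =
      d p * z ^ p.2 * q ^ p.1 := by
    rw [Complex.ofReal_tsum, ← tsum_mul_right, ← tsum_mul_right]
    refine tsum_congr fun s => ?_
    obtain ⟨h3, h4⟩ := Prod.ext_iff.1 (show e s = p from s.2)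
    rw [← h3, ← h4]
  simp only [h2] at h1
  refine ((h1.prod_fiberwise fun m => ?_).tsum_eq).symm
  rw [Finsupp.onFinset_sum _ (by simp), sum_mul]
  refine hasSum_sum_of_ne_finset_zero fun j hj => ?_
  have : d (m, j) = 0 := by_contra fun h => hj (hd m j h)
  simp [this]

end IsNonnegSeries

end NonnegSeries

section Quotients

variable {z q : ℂ}

lemma brkt_div_brkt_two (hq : ‖q‖ < 1) (hb : brkt z q ≠ 0) :
    Eprod (q ^ 2) * brkt z (q ^ 2) / brkt z q = Eprod (q ^ 2) / brkt (z * q) (q ^ 2) := by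
  have hq2 := norm_pow_lt_one_s19 hq two_ne_zero
  have h : brkt z q = brkt z (q ^ 2) * brkt (z * q) (q ^ 2) := by
    have hdiv : q ^ 2 / (z * q) = q / z := by
      rcases eq_or_ne q 0 with rfl | h0
      · simp
      · rw [sq, mul_div_mul_right _ _ h0]
    rw [brkt_eq_poch_mul z hq, brkt_eq_poch_mul z hq2, brkt_eq_poch_mul (z * q) hq2, hdiv,
      poch_eq_prod_poch_pow z hq two_ne_zero, poch_eq_prod_poch_pow (q / z) hq two_ne_zero]
    simp only [prod_range_succ, prod_range_zero, one_mul, pow_zero, mul_one, pow_one]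
    rw [show q / z * q = q ^ 2 / z by ring]
    ring
  rw [h] at hb ⊢
  rw [mul_comm (Eprod _), mul_div_mul_left _ _ (left_ne_zero_of_mul hb)]

lemma brkt_eq_mul_three (z : ℂ) (hq : ‖q‖ < 1) :
    brkt z q = brkt z (q ^ 3) * (poch (z * q) (q ^ 3) * poch (z * q ^ 2) (q ^ 3)) *
      (poch (q / z) (q ^ 3) * poch (q ^ 2 / z) (q ^ 3)) := by
  rw [brkt_eq_poch_mul z hq, brkt_eq_poch_mul z (norm_pow_lt_one_s19 hq three_ne_zero),
    poch_eq_prod_poch_pow z hq three_ne_zero, poch_eq_prod_poch_pow (q / z) hq three_ne_zero]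
  simp only [prod_range_succ, prod_range_zero, one_mul, pow_zero, mul_one, pow_one]
  rw [show q / z * q = q ^ 2 / z by ring, show q / z * q ^ 2 = q ^ 3 / z by ring]
  ring

lemma brkt_eq_one_sub_mul (z : ℂ) (hq : ‖q‖ < 1) :
    brkt z q = (1 - z) * (poch (z * q) q * poch (q / z) q) := by
  rw [brkt_eq_poch_mul z hq, poch_eq_one_sub_mul z hq, mul_assoc]

lemma brkt_div_brkt_three (hq : ‖q‖ < 1) :
    Eprod (q ^ 3) * brkt (z ^ 2) (q ^ 3) / brkt z q =
      ((1 - z ^ 2) * Eprod (q ^ 3) / brkt z (q ^ 3)) *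
        (poch (z ^ 2 * q ^ 3) (q ^ 3) /
          (poch (z * q) (q ^ 3) * poch (z * q ^ 2) (q ^ 3))) *
        (poch (q ^ 3 / z ^ 2) (q ^ 3) /
          (poch (q / z) (q ^ 3) * poch (q ^ 2 / z) (q ^ 3))) := by
  rw [brkt_eq_mul_three z hq, brkt_eq_one_sub_mul (z ^ 2) (norm_pow_lt_one_s19 hq three_ne_zero),
    div_mul_div_comm, div_mul_div_comm]
  ring

end Quotients

namespace IsNonnegSeries

variable {a b : ℂ → ℂ → ℂ} {m : ℕ}

lemma mul_qpow (hm : m ≠ 0) : IsNonnegSeries 0 fun z q => z * q ^ m := by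
  simpa using monomial (K := 0) m 1 (by simp; lia)

lemma qpow_div (hm : m ≠ 0) : IsNonnegSeries 0 fun z q => q ^ m / z := by
  simpa [div_eq_inv_mul] using monomial (K := 0) m (-1) (by simp; lia)

lemma qpow (m : ℕ) : IsNonnegSeries 0 fun _ q => q ^ m := by
  simpa using monomial (K := 0) m 0 (by simp)

lemma inv_prod (hm : m ≠ 0) (e n : ℕ) :
    IsNonnegSeries 0 fun _ q => (∏ j ∈ range n, (1 - q ^ m * (q ^ m) ^ (j + e)))⁻¹ := by
  have h (j : ℕ) : IsNonnegSeries 0 fun _ q => (1 - q ^ m * (q ^ m) ^ (j + e))⁻¹ := by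
    simpa only [pow_mul, pow_succ'] using
      inv_one_sub_pow (m := m * (j + e + 1)) (mul_ne_zero hm (j + e).succ_ne_zero)
  simpa only [prod_inv_distrib] using prod h n

lemma poch_div (hm : m ≠ 0) (ha : IsNonnegSeries 0 a) (hb : IsNonnegSeries 0 b)
    (ha1 : ∀ z q : ℂ, z ≠ 0 → ‖q‖ * max ‖z‖ ‖z‖⁻¹ < 1 → ‖a z q‖ < 1)
    (hb1 : ∀ z q : ℂ, z ≠ 0 → ‖q‖ * max ‖z‖ ‖z‖⁻¹ < 1 → ‖b z q‖ < 1) :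
    IsNonnegSeries 0 fun z q =>
      poch (a z q * b z q) (q ^ m) / (poch (a z q) (q ^ m) * poch (b z q) (q ^ m)) := by
  refine of_hasSum (fun p : ℕ × ℕ => ?_) fun z q hz hq =>
    hasSum_poch_div (ha1 z q hz hq) (hb1 z q hz hq)
      (norm_pow_lt_one_s19 (norm_lt_one_of_region hz hq) hm)
  simpa only [div_eq_mul_inv, mul_inv, add_zero] using
    (((ha.pow p.1).mul (hb.pow p.2)).mul ((qpow m).pow (p.1 * p.2))).mul
      ((inv_prod hm 0 p.1).mul (inv_prod hm 0 p.2))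

/-- `(1 + z)` times the crank generating function in base `q ^ m`. In the double series for the
latter only the constant term `1 - q ^ m` has a negative coefficient, and after multiplying by
`1 + z` it is absorbed by the terms `z * q ^ m` and `q ^ m / z`. -/
lemma one_add_mul_Eprod_div (hm : m ≠ 0) :
    IsNonnegSeries 1 fun z q => (1 + z) *
      (Eprod (q ^ m) / (poch (z * q ^ m) (q ^ m) * poch (q ^ m / z) (q ^ m))) := by
  let U (z q : ℂ) (p : ℕ × ℕ) : ℂ := (1 + z) * (1 - q ^ m) *
    ((z * q ^ m) ^ p.1 * (q ^ m / z) ^ p.2 * (q ^ m) ^ (p.1 * p.2) /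
      ((∏ j ∈ range p.1, (1 - q ^ m * (q ^ m) ^ j)) * ∏ j ∈ range p.2, (1 - q ^ m * (q ^ m) ^ j)))
  have hz1 : IsNonnegSeries 1 fun z _ => 1 + z :=
    (one.mono zero_le_one).add (by simpa using monomial (K := 1) 0 1 (by simp))
  have hne {z q : ℂ} (hz : z ≠ 0) (hq : ‖q‖ * max ‖z‖ ‖z‖⁻¹ < 1) : 1 - q ^ m ≠ 0 := by
    have h := norm_pow_lt_one_s19 (norm_lt_one_of_region hz hq) hm
    exact sub_ne_zero.2 fun h1 => by rw [← h1, norm_one] at h; exact h.false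
  have hU (p : ℕ × ℕ) (hp : p ≠ (0, 0)) : IsNonnegSeries 1 fun z q => U z q p := by
    have hmon := (((mul_qpow hm).pow p.1).mul ((qpow_div hm).pow p.2)).mul ((qpow m).pow (p.1 * p.2))
    obtain ⟨_ | n, k⟩ := p
    · obtain ⟨k, rfl⟩ := Nat.exists_eq_succ_of_ne_zero (n := k) (by simpa using hp)
      refine (hz1.mul (hmon.mul (inv_prod hm 1 k))).congr fun z q hz hq => ?_
      have := hne hz hq
      simp only [U, prod_range_succ' _ k, prod_range_zero, pow_zero, mul_one, one_mul]
      field_simp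
    · refine (hz1.mul (hmon.mul ((inv_prod hm 1 n).mul (inv_prod hm 0 k)))).congr
        fun z q hz hq => ?_
      have := hne hz hq
      simp only [U, prod_range_succ' _ n, pow_zero, mul_one, add_zero]
      field_simp
  refine of_hasSum (F := fun p z q => Function.update (Function.update (Function.update (U z q)
    (0, 0) (1 + z)) (1, 0) (z ^ 2 * q ^ m)) (0, 1) (q ^ m / z) p) (fun p => ?_)
    fun z q hz hq => ?_
  · by_cases h01 : p = (0, 1)
    · simpa [h01] using (qpow_div hm).mono zero_le_one
    by_cases h10 : p = (1, 0)
    · simpa [h10] using monomial (K := 1) m 2 (by simp; lia)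
    by_cases h00 : p = (0, 0)
    · simpa [h00] using hz1
    simpa [h01, h10, h00] using hU p h00
  · have hQ1 := norm_pow_lt_one_s19 (norm_lt_one_of_region hz hq) hm
    have hQ0 := hne hz hq
    have hq' := region_pow hz hq hm
    have hsum := (hasSum_poch_div (norm_mul_lt_one_of_region hq') (norm_div_lt_one_of_region hq')
      hQ1).mul_left ((1 + z) * (1 - q ^ m))
    have h := (((show HasSum (U z q) _ from hsum).update (0, 0) (1 + z)).update (1, 0)
      (z ^ 2 * q ^ m)).update (0, 1) (q ^ m / z)
    convert h using 1
    · rfl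
    have hE : Eprod (q ^ m) = (1 - q ^ m) * poch (z * q ^ m * (q ^ m / z)) (q ^ m) := by
      rw [Eprod_eq_poch, poch_eq_one_sub_mul _ hQ1]
      congr 2
      field_simp
    have h00 : U z q (0, 0) = (1 + z) * (1 - q ^ m) := by simp [U]
    have h10 : U z q (1, 0) = (1 + z) * (z * q ^ m) := by
      simp [U]
      field_simp
    have h01 : U z q (0, 1) = (1 + z) * (q ^ m / z) := by
      simp [U]
      field_simp
    simp only [Function.update_apply, Prod.mk.injEq, zero_ne_one, one_ne_zero, and_false,
      false_and, if_false, h00, h10, h01, hE]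
    field_simp
    ring

end IsNonnegSeries

/-- The `n = 2` and `n = 3` cases of the nonnegativity of
`E(qⁿ)[z^{n-1};qⁿ]_∞/[z;q]_∞`:
(i) `E(q²)[z;q²]_∞/[z;q]_∞ = E(q²)/[zq;q²]_∞` and this series has nonnegative
coefficients; (ii) `E(q³)[z²;q³]_∞/[z;q]_∞` factors as
`((1-z²)E(q³)/[z;q³]_∞) ((z²q³;q³)_∞/((zq;q³)_∞(zq²;q³)_∞))
 ((q³/z²;q³)_∞/((q/z;q³)_∞(q²/z;q³)_∞))` and has nonnegative coefficients.
Nonnegativity: the coefficient of `qⁿ` is a Laurent polynomial in `z` recorded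
by a finitely supported `c n : ℤ →₀ ℝ`, the equalities holding away from zeros
of the denominators, in a region of absolute convergence. -/
theorem n_two_three_nonneg :
    (∀ z q : ℂ, z ≠ 0 → ‖q‖ < 1 → brkt z q ≠ 0 →
      Eprod (q ^ 2) * brkt z (q ^ 2) / brkt z q =
        Eprod (q ^ 2) / brkt (z * q) (q ^ 2)) ∧
    (∃ c : ℕ → (ℤ →₀ ℝ), (∀ n : ℕ, ∀ i : ℤ, 0 ≤ c n i) ∧
      ∀ z q : ℂ, z ≠ 0 → ‖q‖ * max ‖z‖ ‖z‖⁻¹ < 1 → brkt z q ≠ 0 →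
        Eprod (q ^ 2) * brkt z (q ^ 2) / brkt z q =
          ∑' n : ℕ, ((c n).sum fun i r => (r : ℂ) * z ^ i) * q ^ n) ∧
    (∀ z q : ℂ, z ≠ 0 → ‖q‖ < 1 → brkt z q ≠ 0 →
      Eprod (q ^ 3) * brkt (z ^ 2) (q ^ 3) / brkt z q =
        ((1 - z ^ 2) * Eprod (q ^ 3) / brkt z (q ^ 3)) *
          (poch (z ^ 2 * q ^ 3) (q ^ 3) /
            (poch (z * q) (q ^ 3) * poch (z * q ^ 2) (q ^ 3))) *
          (poch (q ^ 3 / z ^ 2) (q ^ 3) /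
            (poch (q / z) (q ^ 3) * poch (q ^ 2 / z) (q ^ 3)))) ∧
    (∃ c : ℕ → (ℤ →₀ ℝ), (∀ n : ℕ, ∀ i : ℤ, 0 ≤ c n i) ∧
      ∀ z q : ℂ, z ≠ 0 → ‖q‖ * max ‖z‖ ‖z‖⁻¹ < 1 → brkt z q ≠ 0 →
        Eprod (q ^ 3) * brkt (z ^ 2) (q ^ 3) / brkt z q =
          ∑' n : ℕ, ((c n).sum fun i r => (r : ℂ) * z ^ i) * q ^ n) := by
  refine ⟨fun z q _ hq hb => brkt_div_brkt_two hq hb, ?_, fun z q _ hq _ => brkt_div_brkt_three hq,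
    ?_⟩
  · have h := IsNonnegSeries.poch_div two_ne_zero (IsNonnegSeries.mul_qpow one_ne_zero)
      (IsNonnegSeries.qpow_div one_ne_zero)
      (fun z q hz hq => by simpa using norm_mul_lt_one_of_region hq)
      (fun z q hz hq => by simpa using norm_div_lt_one_of_region hq)
    obtain ⟨c, hc0, hc⟩ := h.exists_coeff
    refine ⟨c, hc0, fun z q hz hq hb => ?_⟩
    have hq1 := norm_lt_one_of_region hz hq
    rw [← hc z q hz hq, brkt_div_brkt_two hq1 hb, Eprod_eq_poch,
      brkt_eq_poch_mul _ (norm_pow_lt_one_s19 hq1 two_ne_zero)]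
    have h1 : q ^ 2 / (z * q) = q / z := by
      rcases eq_or_ne q 0 with rfl | h0
      · simp
      · rw [sq, mul_div_mul_right _ _ h0]
    have h2 : z * q * (q / z) = q ^ 2 := by field_simp
    rw [pow_one, h1, h2]
  · have h1 := IsNonnegSeries.poch_div three_ne_zero (IsNonnegSeries.mul_qpow one_ne_zero)
      (IsNonnegSeries.mul_qpow two_ne_zero)
      (fun z q hz hq => by simpa using norm_mul_lt_one_of_region hq)
      (fun z q hz hq => norm_mul_lt_one_of_region (region_pow hz hq two_ne_zero))
    have h2 := IsNonnegSeries.poch_div three_ne_zero (IsNonnegSeries.qpow_div one_ne_zero)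
      (IsNonnegSeries.qpow_div two_ne_zero)
      (fun z q hz hq => by simpa using norm_div_lt_one_of_region hq)
      (fun z q hz hq => norm_div_lt_one_of_region (region_pow hz hq two_ne_zero))
    obtain ⟨c, hc0, hc⟩ :=
      (((IsNonnegSeries.one_add_mul_Eprod_div three_ne_zero).mul h1).mul h2).exists_coeff
    refine ⟨c, hc0, fun z q hz hq hb => ?_⟩
    have hq1 := norm_lt_one_of_region hz hq
    have hq3 := norm_pow_lt_one_s19 hq1 three_ne_zero
    rw [brkt_eq_mul_three z hq1, brkt_eq_one_sub_mul z hq3] at hb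
    have hz1 : 1 - z ≠ 0 := left_ne_zero_of_mul (left_ne_zero_of_mul (left_ne_zero_of_mul hb))
    rw [← hc z q hz hq, brkt_div_brkt_three hq1, brkt_eq_one_sub_mul z hq3,
      show 1 - z ^ 2 = (1 - z) * (1 + z) by ring, mul_assoc (1 - z), mul_div_mul_left _ _ hz1,
      mul_div_assoc, pow_one, show z * q * (z * q ^ 2) = z ^ 2 * q ^ 3 by ring,
      show q / z * (q ^ 2 / z) = q ^ 3 / z ^ 2 by ring]
end
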